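/- arXiv:1302.6757 — 7 statements merged into one kernel-verified Lean document; each statement's English description precedes it below -/
import Mathlib

section
/- Let σ_P, σ_R, p, r > 0 and ρ ∈ (−1, 1) with r > σ_R²/2. Define q(v) = σ_P² + 2ρσ_Pσ_R v + σ_R² v² (which is strictly positive for all v ≥ 0) and K(u) = ∫₀^u exp( − ∫₀^v 2(p + r s)/q(s) ds ) dv for u ≥ 0. Then K(u) converges to a finite limit K(∞) as u → ∞, and the function h(u) = 1 − K(u)/K(∞) is twice continuously differentiable on (0, ∞), satisfies ½ q(u) h''(u) + (p + r u) h'(u) = 0 for all u > 0, and moreover h(0) = 1, h is strictly decreasing on [0, ∞) with values in [0, 1], and lim_{u→∞} h(u) = 0. -/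
open Real Filter MeasureTheory Set

/-- The scale density `exp (-∫₀ᵛ f)` of a one-dimensional diffusion with drift-to-variance ratio
`f / 2`. -/
noncomputable def scaleDensity (f : ℝ → ℝ) (v : ℝ) : ℝ :=
  Real.exp (-∫ s in (0 : ℝ)..v, f s)

/-- The scale function `∫₀ᵘ exp (-∫₀ᵛ f) dv`. -/
noncomputable def scaleFunction (f : ℝ → ℝ) (u : ℝ) : ℝ :=
  ∫ v in (0 : ℝ)..u, scaleDensity f v

theorem scaleDensity_pos (f : ℝ → ℝ) (v : ℝ) : 0 < scaleDensity f v :=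
  Real.exp_pos _

theorem hasDerivAt_scaleDensity {f : ℝ → ℝ} (hf : Continuous f) (v : ℝ) :
    HasDerivAt (scaleDensity f) (-(f v * scaleDensity f v)) v := by
  have h := (hf.integral_hasStrictDerivAt 0 v).hasDerivAt.neg.exp
  refine h.congr_deriv ?_
  simp only [scaleDensity, Pi.neg_apply]
  ring

theorem continuous_scaleDensity {f : ℝ → ℝ} (hf : Continuous f) : Continuous (scaleDensity f) :=
  continuous_iff_continuousAt.2 fun v => (hasDerivAt_scaleDensity hf v).continuousAt

theorem hasDerivAt_scaleFunction {f : ℝ → ℝ} (hf : Continuous f) (u : ℝ) :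
    HasDerivAt (scaleFunction f) (scaleDensity f u) u :=
  ((continuous_scaleDensity hf).integral_hasStrictDerivAt 0 u).hasDerivAt

theorem contDiff_scaleDensity {f : ℝ → ℝ} (hf : Continuous f) : ContDiff ℝ 1 (scaleDensity f) := by
  refine contDiff_one_iff_deriv.2
    ⟨fun v => (hasDerivAt_scaleDensity hf v).differentiableAt, ?_⟩
  rw [funext fun v => (hasDerivAt_scaleDensity hf v).deriv]
  exact (hf.mul (continuous_scaleDensity hf)).neg

theorem contDiff_scaleFunction {f : ℝ → ℝ} (hf : Continuous f) :
    ContDiff ℝ 2 (scaleFunction f) := by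
  rw [show (2 : WithTop ℕ∞) = 1 + 1 by norm_num, contDiff_succ_iff_deriv]
  refine ⟨fun u => (hasDerivAt_scaleFunction hf u).differentiableAt, by simp, ?_⟩
  rw [funext fun u => (hasDerivAt_scaleFunction hf u).deriv]
  exact contDiff_scaleDensity hf

theorem scaleFunction_zero (f : ℝ → ℝ) : scaleFunction f 0 = 0 := by
  simp [scaleFunction]

theorem strictMono_scaleFunction {f : ℝ → ℝ} (hf : Continuous f) :
    StrictMono (scaleFunction f) :=
  strictMono_of_deriv_pos fun u => by
    rw [(hasDerivAt_scaleFunction hf u).deriv]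
    exact scaleDensity_pos f u

/-- If `s * f s ≥ α` for large `s` and some `α > 1`, then `(α - 1) * scaleFunction f u +
u * scaleDensity f u` is eventually decreasing, so the scale function is bounded. -/
theorem bddAbove_range_scaleFunction {f : ℝ → ℝ} (hf : Continuous f) {α A : ℝ} (hα : 1 < α)
    (hA : 0 ≤ A) (hfA : ∀ s ≥ A, α ≤ s * f s) : BddAbove (range (scaleFunction f)) := by
  have hd : ∀ u, HasDerivAt (fun u => (α - 1) * scaleFunction f u + u * scaleDensity f u)
      ((α - u * f u) * scaleDensity f u) u := fun u => by
    refine (((hasDerivAt_scaleFunction hf u).const_mul (α - 1)).add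
      ((hasDerivAt_id u).mul (hasDerivAt_scaleDensity hf u))).congr_deriv ?_
    simp only [id]
    ring
  have hanti : AntitoneOn (fun u => (α - 1) * scaleFunction f u + u * scaleDensity f u)
      (Ici A) := by
    refine antitoneOn_of_deriv_nonpos (convex_Ici A)
      (fun u _ => (hd u).continuousAt.continuousWithinAt)
      (fun u _ => (hd u).differentiableAt.differentiableWithinAt) fun u hu => ?_
    rw [interior_Ici, mem_Ioi] at hu
    rw [(hd u).deriv]
    exact mul_nonpos_of_nonpos_of_nonneg (sub_nonpos.2 (hfA u hu.le)) (scaleDensity_pos f u).le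
  refine ⟨((α - 1) * scaleFunction f A + A * scaleDensity f A) / (α - 1), ?_⟩
  rintro _ ⟨u, rfl⟩
  have hα' : 0 < α - 1 := sub_pos.2 hα
  refine ((strictMono_scaleFunction hf).monotone (le_max_left u A)).trans ?_
  rw [le_div_iff₀ hα']
  have h := hanti self_mem_Ici (le_max_right u A) (le_max_right u A)
  have h' : 0 ≤ max u A * scaleDensity f (max u A) :=
    mul_nonneg (hA.trans (le_max_right u A)) (scaleDensity_pos f _).le
  dsimp only at h
  linarith

theorem exists_forall_ge_quadratic_nonneg {c : ℝ} (hc : 0 < c) (b d : ℝ) :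
    ∃ A ≥ (0 : ℝ), ∀ s ≥ A, 0 ≤ c * s ^ 2 + b * s + d := by
  refine ⟨max 1 ((|b| + |d|) / c), zero_le_one.trans (le_max_left _ _), fun s hs => ?_⟩
  have h1 : 1 ≤ s := (le_max_left _ _).trans hs
  have h2 : |b| + |d| ≤ s * c := (div_le_iff₀ hc).1 ((le_max_right _ _).trans hs)
  nlinarith [mul_le_mul_of_nonneg_right h2 (zero_le_one.trans h1), neg_abs_le b, neg_abs_le d,
    mul_nonneg (abs_nonneg d) (sub_nonneg.2 h1),
    mul_nonneg (neg_le_iff_add_nonneg.1 (neg_abs_le b)) (zero_le_one.trans h1)]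

theorem correlated_variance_pos {a b ρ : ℝ} (ha : 0 < a) (hρ : ρ ∈ Ioo (-1 : ℝ) 1) (v : ℝ) :
    0 < a ^ 2 + 2 * ρ * a * b * v + b ^ 2 * v ^ 2 := by
  have h : 0 < (1 - ρ ^ 2) * a ^ 2 :=
    mul_pos (by nlinarith [mul_pos (neg_lt_iff_pos_add.1 hρ.1) (sub_pos.2 hρ.2)]) (pow_pos ha 2)
  nlinarith [sq_nonneg (ρ * a + b * v)]

/-- Example 3.1 of Yin–Wen, case `|ρ| < 1`: the explicit solution
`h(u) = 1 - K(u)/K(∞)` of the boundary value problem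
`½ q(u) h''(u) + (p + r u) h'(u) = 0`, `h(0) = 1`, `h(+∞) = 0`,
where `q(v) = σP² + 2ρσPσR v + σR² v²`. -/
theorem ruin_probability_jump_free_correlated
    (σP σR p r ρ : ℝ)
    (hσP : 0 < σP) (hσR : 0 < σR) (hp : 0 < p) (hr : 0 < r)
    (hρ : ρ ∈ Set.Ioo (-1 : ℝ) 1) (hrσ : σR ^ 2 / 2 < r)
    (q K : ℝ → ℝ)
    (hq : q = fun v => σP ^ 2 + 2 * ρ * σP * σR * v + σR ^ 2 * v ^ 2)
    (hK : K = fun u => ∫ v in (0 : ℝ)..u,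
        Real.exp (-∫ s in (0 : ℝ)..v, 2 * (p + r * s) / q s)) :
    (∀ v ≥ (0 : ℝ), 0 < q v) ∧
    ∃ Kinf : ℝ, Filter.Tendsto K Filter.atTop (nhds Kinf) ∧
      ∀ h : ℝ → ℝ, h = (fun u => 1 - K u / Kinf) →
        ContDiffOn ℝ 2 h (Set.Ioi 0) ∧
        (∀ u > (0 : ℝ),
          (1 / 2) * q u * deriv (deriv h) u + (p + r * u) * deriv h u = 0) ∧
        h 0 = 1 ∧
        StrictAntiOn h (Set.Ici 0) ∧
        (∀ u ≥ (0 : ℝ), h u ∈ Set.Icc (0 : ℝ) 1) ∧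
        Filter.Tendsto h Filter.atTop (nhds 0) := by
  have hqpos : ∀ v, 0 < q v := fun v => by
    rw [hq]
    exact correlated_variance_pos hσP hρ v
  have hqc : Continuous q := by
    rw [hq]
    fun_prop
  have hf : Continuous fun s => 2 * (p + r * s) / q s :=
    Continuous.div (by fun_prop) hqc fun s => (hqpos s).ne'
  set f : ℝ → ℝ := fun s => 2 * (p + r * s) / q s with hf_def
  replace hK : K = scaleFunction f := hK
  have hσR2 : 0 < σR ^ 2 := pow_pos hσR 2
  obtain ⟨α, hα, hαr⟩ : ∃ α, 1 < α ∧ α < 2 * r / σR ^ 2 :=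
    exists_between ((one_lt_div hσR2).2 (by linarith))
  rw [lt_div_iff₀ hσR2] at hαr
  obtain ⟨A, hA, hquad⟩ := exists_forall_ge_quadratic_nonneg (sub_pos.2 hαr)
    (2 * p - 2 * α * ρ * σP * σR) (-(α * σP ^ 2))
  have hfA : ∀ s ≥ A, α ≤ s * f s := fun s hs => by
    have h := hquad s hs
    rw [hf_def, mul_div_assoc', le_div_iff₀ (hqpos s), hq]
    linarith
  have hbdd := bddAbove_range_scaleFunction hf hα hA hfA
  have hmono := strictMono_scaleFunction hf
  have hlim := tendsto_atTop_ciSup hmono.monotone hbdd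
  refine ⟨fun v _ => hqpos v, ⨆ u, scaleFunction f u, hK ▸ hlim, ?_⟩
  have hle : ∀ u, scaleFunction f u ≤ ⨆ u, scaleFunction f u := le_ciSup hbdd
  generalize (⨆ u, scaleFunction f u) = L at hlim hle
  have hL : 0 < L := (scaleFunction_zero f ▸ hmono zero_lt_one).trans_le (hle 1)
  rintro h rfl
  subst hK
  have hd : deriv (fun u => 1 - scaleFunction f u / L) = fun u => -(scaleDensity f u / L) :=
    funext fun u => (((hasDerivAt_scaleFunction hf u).div_const L).const_sub 1).deriv
  refine ⟨(contDiff_const.sub ((contDiff_scaleFunction hf).div_const L)).contDiffOn,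
    fun u _ => ?_, by simp [scaleFunction_zero], fun x _ y _ hxy => ?_,
    fun u hu => ⟨?_, ?_⟩, ?_⟩
  · rw [hd, ((hasDerivAt_scaleDensity hf u).div_const L).fun_neg.deriv]
    have hqf : q u * f u = 2 * (p + r * u) := mul_div_cancel₀ _ (hqpos u).ne'
    linear_combination (scaleDensity f u / (2 * L)) * hqf
  · exact sub_lt_sub_left (div_lt_div_of_pos_right (hmono hxy) hL) 1
  · exact sub_nonneg.2 ((div_le_one hL).2 (hle u))
  · exact sub_le_self 1 (div_nonneg (scaleFunction_zero f ▸ hmono.monotone hu) hL.le)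
  · simpa [hL.ne'] using (hlim.div_const L).const_sub 1
end

section
/- Let σ_P, σ_R, p, r > 0 and δ > r. Set β = √((2r/σ_R² − 1)² + 8δ/σ_R²) − 1 and α = ½[√((2r/σ_R² − 1)² + 8δ/σ_R²) − (1 + 2r/σ_R²)] (so β > 0 and α > 0). Then the function x ↦ D(x, α+1) is twice differentiable on ℝ and satisfies ½(σ_P² + σ_R² x²) D''(x, α+1) + (p + r x) D'(x, α+1) = δ D(x, α+1) for all x ∈ ℝ, where derivatives are taken in the first variable. -/
open Real Filter MeasureTheory Set

/-- The fundamental solution `D(x, λ)` of Paulsen–Gjessing (1997a), used in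
Examples 3.2, 4.1 and 4.2 of Yin–Wen:
`D(x,λ) = σP^{-(1+β)} σR^{-(1+λ)} ∫_{arctan(σR x/σP)}^{π/2}
  (cos t)^{β-λ} (σP sin t - σR x cos t)^λ exp(-2pt/(σPσR)) dt`. -/
noncomputable def Dfun (σP σR p β x lam : ℝ) : ℝ :=
  σP ^ (-(1 + β)) * σR ^ (-(1 + lam)) *
    ∫ t in Real.arctan (σR * x / σP)..(Real.pi / 2),
      Real.cos t ^ (β - lam) * (σP * Real.sin t - σR * x * Real.cos t) ^ lam *
        Real.exp (-2 * p * t / (σP * σR))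

/-- The fundamental solution `E(x, λ)` of Paulsen–Gjessing (1997a):
`E(x,λ) = σP^{-(1+β)} σR^{-(1+λ)} ∫_{-π/2}^{arctan(σR x/σP)}
  (cos t)^{β-λ} (σR x cos t - σP sin t)^λ exp(-2pt/(σPσR)) dt`. -/
noncomputable def Efun (σP σR p β x lam : ℝ) : ℝ :=
  σP ^ (-(1 + β)) * σR ^ (-(1 + lam)) *
    ∫ t in (-(Real.pi / 2))..Real.arctan (σR * x / σP),
      Real.cos t ^ (β - lam) * (σR * x * Real.cos t - σP * Real.sin t) ^ lam *
        Real.exp (-2 * p * t / (σP * σR))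

/-- The weight `(σP² + σR² z²)^{-m} exp(-2p arctan(σR z / σP) / (σP σR))`. -/
noncomputable def pearsonWeight (σP σR p m z : ℝ) : ℝ :=
  (σP ^ 2 + σR ^ 2 * z ^ 2) ^ (-m) *
    Real.exp (-2 * p * Real.arctan (σR * z / σP) / (σP * σR))

/-- The Weyl-type fractional integral `∫₀^∞ u^a w(x + u) du` of the weight `pearsonWeight`. -/
noncomputable def weylIntegral (σP σR p m a x : ℝ) : ℝ :=
  ∫ u in Ioi (0 : ℝ), u ^ a * pearsonWeight σP σR p m (x + u)

section

variable {σP σR p m a : ℝ}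

lemma quadratic_pos (hσP : 0 < σP) (z : ℝ) : 0 < σP ^ 2 + σR ^ 2 * z ^ 2 := by positivity

lemma pearsonWeight_nonneg (hσP : 0 < σP) (z : ℝ) : 0 ≤ pearsonWeight σP σR p m z := by
  have := quadratic_pos (σR := σR) hσP z
  unfold pearsonWeight
  positivity

lemma pearsonWeight_eq_mul_succ (hσP : 0 < σP) (z : ℝ) :
    pearsonWeight σP σR p m z =
      (σP ^ 2 + σR ^ 2 * z ^ 2) * pearsonWeight σP σR p (m + 1) z := by
  have hQ := quadratic_pos (σR := σR) hσP z
  have h : (σP ^ 2 + σR ^ 2 * z ^ 2) ^ (-m) =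
      (σP ^ 2 + σR ^ 2 * z ^ 2) * (σP ^ 2 + σR ^ 2 * z ^ 2) ^ (-(m + 1)) := by
    rw [neg_add', Real.rpow_sub_one hQ.ne']
    field_simp
  rw [pearsonWeight, h, pearsonWeight]
  ring

lemma hasDerivAt_pearsonWeight (hσP : 0 < σP) (hσR : 0 < σR) (z : ℝ) :
    HasDerivAt (pearsonWeight σP σR p m)
      (-(2 * m * σR ^ 2 * z + 2 * p) * pearsonWeight σP σR p (m + 1) z) z := by
  have hQ := quadratic_pos (σR := σR) hσP z
  have h1 : HasDerivAt (fun z : ℝ => σP ^ 2 + σR ^ 2 * z ^ 2) (σR ^ 2 * (2 * z)) z := by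
    simpa using ((hasDerivAt_pow 2 z).const_mul (σR ^ 2)).const_add (σP ^ 2)
  have h2 := h1.rpow_const (p := -m) (Or.inl hQ.ne')
  have h3 : HasDerivAt (fun z : ℝ => σR * z / σP) (σR / σP) z := by
    simpa using ((hasDerivAt_id z).const_mul σR).div_const σP
  have h4 := ((h3.arctan.const_mul (-2 * p)).div_const (σP * σR)).exp
  refine (h2.mul h4).congr_deriv ?_
  rw [pearsonWeight, neg_add' m 1, Real.rpow_sub_one hQ.ne']
  have e3 : 1 + (σR * z / σP) ^ 2 = (σP ^ 2 + σR ^ 2 * z ^ 2) / σP ^ 2 := by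
    field_simp
  rw [e3]
  field_simp
  ring

lemma continuous_pearsonWeight (hσP : 0 < σP) (hσR : 0 < σR) :
    Continuous (pearsonWeight σP σR p m) :=
  continuous_iff_continuousAt.2 fun z => (hasDerivAt_pearsonWeight hσP hσR z).continuousAt

/-- Uniform decay of the weight under translation by a bounded amount. -/
lemma exists_pearsonWeight_add_le (hσP : 0 < σP) (hσR : 0 < σR) (hp : 0 < p) (hm : 0 < m) (x : ℝ) :
    ∃ C, 0 ≤ C ∧ ∀ y ∈ Metric.ball x 1, ∀ u : ℝ,
      pearsonWeight σP σR p m (y + u) ≤ C * (1 + u ^ 2) ^ (-m) := by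
  set R := |x| + 1
  set K := (1 + 2 * R ^ 2) / σP ^ 2 + 2 / σR ^ 2
  have hK : 0 < K := by positivity
  refine ⟨K ^ m * Real.exp (2 * p * (Real.pi / 2) / (σP * σR)), by positivity, fun y hy u => ?_⟩
  have hQ := quadratic_pos (σR := σR) hσP (y + u)
  have hyR : y ^ 2 ≤ R ^ 2 := by
    apply sq_le_sq'
    all_goals
      rw [Metric.mem_ball, Real.dist_eq, abs_lt] at hy
      have h1 := neg_abs_le x
      have h2 := le_abs_self x
      simp only [R]
      linarith [hy.1, hy.2]
  have h1 : 1 + u ^ 2 ≤ K * (σP ^ 2 + σR ^ 2 * (y + u) ^ 2) := by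
    have : K * (σP ^ 2 + σR ^ 2 * (y + u) ^ 2) = (1 + 2 * R ^ 2) + 2 * (y + u) ^ 2 +
        ((1 + 2 * R ^ 2) / σP ^ 2 * (σR ^ 2 * (y + u) ^ 2) + 2 / σR ^ 2 * σP ^ 2) := by
      simp only [K]
      field_simp
      ring
    rw [this]
    have : 0 ≤ (1 + 2 * R ^ 2) / σP ^ 2 * (σR ^ 2 * (y + u) ^ 2) + 2 / σR ^ 2 * σP ^ 2 := by
      positivity
    nlinarith [sq_nonneg (2 * y + u)]
  have h2 : (σP ^ 2 + σR ^ 2 * (y + u) ^ 2) ^ (-m) ≤ K ^ m * (1 + u ^ 2) ^ (-m) := by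
    have h3 := Real.rpow_le_rpow_of_nonpos (by positivity) h1 (by linarith : -m ≤ 0)
    rw [Real.mul_rpow hK.le hQ.le, Real.rpow_neg hK.le, inv_mul_le_iff₀ (by positivity)] at h3
    exact h3
  have h3 : Real.exp (-2 * p * Real.arctan (σR * (y + u) / σP) / (σP * σR)) ≤
      Real.exp (2 * p * (Real.pi / 2) / (σP * σR)) := by
    refine Real.exp_le_exp.2 (div_le_div_of_nonneg_right ?_ (by positivity))
    nlinarith [Real.neg_pi_div_two_lt_arctan (σR * (y + u) / σP)]
  calc _ ≤ (K ^ m * (1 + u ^ 2) ^ (-m)) * Real.exp (2 * p * (Real.pi / 2) / (σP * σR)) := by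
        unfold pearsonWeight
        gcongr
    _ = _ := by ring

lemma one_add_sq_rpow_neg_le (hm : 0 < m) {u : ℝ} (hu : 0 < u) :
    u ^ a * (1 + u ^ 2) ^ (-m) ≤ u ^ (a - 2 * m) := by
  have : (1 + u ^ 2) ^ (-m) ≤ (u ^ 2) ^ (-m) :=
    Real.rpow_le_rpow_of_nonpos (by positivity) (by linarith) (by linarith)
  rw [sub_eq_add_neg, Real.rpow_add hu]
  gcongr
  refine this.trans_eq ?_
  rw [← Real.rpow_natCast, ← Real.rpow_mul hu.le]
  congr 1
  push_cast
  ring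

lemma integrableOn_rpow_mul_one_add_sq (hm : 0 < m) (ha : -1 < a) (ham : a < 2 * m - 1) :
    IntegrableOn (fun u : ℝ => u ^ a * (1 + u ^ 2) ^ (-m)) (Ioi 0) := by
  have hmeas : Measurable (fun u : ℝ => u ^ a * (1 + u ^ 2) ^ (-m)) := by fun_prop
  rw [← Ioc_union_Ioi_eq_Ioi zero_le_one]
  refine IntegrableOn.union ?_ ?_
  · have h := (intervalIntegral.intervalIntegrable_rpow' (a := 0) (b := 1) ha)
    rw [intervalIntegrable_iff_integrableOn_Ioc_of_le zero_le_one] at h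
    refine Integrable.mono' h hmeas.aestronglyMeasurable ?_
    refine (ae_restrict_iff' measurableSet_Ioc).2 (.of_forall fun u hu => ?_)
    have hu0 := hu.1
    rw [Real.norm_of_nonneg (by positivity)]
    exact mul_le_of_le_one_right (by positivity)
      (Real.rpow_le_one_of_one_le_of_nonpos (by nlinarith) (by linarith))
  · have h := integrableOn_Ioi_rpow_of_lt (a := a - 2 * m) (c := 1) (by linarith) one_pos
    refine Integrable.mono' h hmeas.aestronglyMeasurable ?_
    refine (ae_restrict_iff' measurableSet_Ioi).2 (.of_forall fun u hu => ?_)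
    have hu0 : (0 : ℝ) < u := one_pos.trans hu
    rw [Real.norm_of_nonneg (by positivity)]
    exact one_add_sq_rpow_neg_le hm hu0

lemma aestronglyMeasurable_rpow_mul_pearsonWeight (hσP : 0 < σP) (hσR : 0 < σR) (x : ℝ) :
    AEStronglyMeasurable (fun u : ℝ => u ^ a * pearsonWeight σP σR p m (x + u))
      (volume.restrict (Ioi 0)) := by
  have := (continuous_pearsonWeight (p := p) (m := m) hσP hσR).measurable
  exact (by fun_prop : Measurable _).aestronglyMeasurable

lemma integrableOn_rpow_mul_pearsonWeight (hσP : 0 < σP) (hσR : 0 < σR) (hp : 0 < p)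
    (hm : 0 < m) (ha : -1 < a) (ham : a < 2 * m - 1) (x : ℝ) :
    IntegrableOn (fun u : ℝ => u ^ a * pearsonWeight σP σR p m (x + u)) (Ioi 0) := by
  obtain ⟨C, hC, hb⟩ := exists_pearsonWeight_add_le hσP hσR hp hm x
  refine Integrable.mono' ((integrableOn_rpow_mul_one_add_sq hm ha ham).const_mul C)
    (aestronglyMeasurable_rpow_mul_pearsonWeight hσP hσR x) ?_
  refine (ae_restrict_iff' measurableSet_Ioi).2 (.of_forall fun u (hu : 0 < u) => ?_)
  rw [Real.norm_of_nonneg (mul_nonneg (by positivity) (pearsonWeight_nonneg hσP _)),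
    mul_left_comm]
  gcongr
  exact hb x (Metric.mem_ball_self one_pos) u

lemma tendsto_rpow_mul_pearsonWeight (hσP : 0 < σP) (hσR : 0 < σR) (hp : 0 < p)
    (hm : 0 < m) (ham : a < 2 * m) (x : ℝ) :
    Tendsto (fun u : ℝ => u ^ a * pearsonWeight σP σR p m (x + u)) atTop (nhds 0) := by
  obtain ⟨C, hC, hb⟩ := exists_pearsonWeight_add_le hσP hσR hp hm x
  have h : Tendsto (fun u : ℝ => C * u ^ (a - 2 * m)) atTop (nhds 0) := by
    simpa using (tendsto_rpow_neg_atTop (y := 2 * m - a) (by linarith)).const_mul C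
  refine tendsto_of_tendsto_of_tendsto_of_le_of_le' tendsto_const_nhds h ?_ ?_
  · filter_upwards [eventually_gt_atTop 0] with u hu
    exact mul_nonneg (by positivity) (pearsonWeight_nonneg hσP _)
  · filter_upwards [eventually_gt_atTop 0] with u hu
    calc u ^ a * pearsonWeight σP σR p m (x + u)
        ≤ u ^ a * (C * (1 + u ^ 2) ^ (-m)) := by
          gcongr
          exact hb x (Metric.mem_ball_self one_pos) u
      _ = C * (u ^ a * (1 + u ^ 2) ^ (-m)) := by ring
      _ ≤ _ := by
          gcongr
          exact one_add_sq_rpow_neg_le hm hu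

/-- The fundamental theorem of calculus for `u^a w(x + u)` on `(0, ∞)`: both boundary terms
vanish. -/
lemma integral_deriv_rpow_mul_pearsonWeight (hσP : 0 < σP) (hσR : 0 < σR) (hp : 0 < p)
    (ha : 0 < a) (ham : a < 2 * m) (x : ℝ)
    (hint : IntegrableOn (fun u : ℝ => a * u ^ (a - 1) * pearsonWeight σP σR p m (x + u) +
      u ^ a * (-(2 * m * σR ^ 2 * (x + u) + 2 * p) * pearsonWeight σP σR p (m + 1) (x + u)))
      (Ioi 0)) :
    ∫ u in Ioi (0 : ℝ), (a * u ^ (a - 1) * pearsonWeight σP σR p m (x + u) +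
      u ^ a * (-(2 * m * σR ^ 2 * (x + u) + 2 * p) *
        pearsonWeight σP σR p (m + 1) (x + u))) = 0 := by
  have hcont : Continuous (fun u : ℝ => u ^ a * pearsonWeight σP σR p m (x + u)) :=
    (Real.continuous_rpow_const ha.le).mul
      ((continuous_pearsonWeight hσP hσR).comp (continuous_const.add continuous_id))
  have h := integral_Ioi_of_hasDerivAt_of_tendsto (a := 0)
    (f := fun u : ℝ => u ^ a * pearsonWeight σP σR p m (x + u))
    hcont.continuousWithinAt (fun u (hu : 0 < u) =>
      (Real.hasDerivAt_rpow_const (p := a) (Or.inl hu.ne')).mul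
        ((hasDerivAt_pearsonWeight hσP hσR (x + u)).comp_const_add x u)) hint
    (tendsto_rpow_mul_pearsonWeight hσP hσR hp (by linarith) ham x)
  rw [h, Real.zero_rpow ha.ne']
  simp

/-- The derivative of the weight is dominated by the weight. -/
lemma exists_abs_deriv_pearsonWeight_le (hσP : 0 < σP) (hσR : 0 < σR) (hp : 0 < p) (hm : 0 < m) :
    ∃ M, 0 ≤ M ∧ ∀ z, |-(2 * m * σR ^ 2 * z + 2 * p) * pearsonWeight σP σR p (m + 1) z| ≤
      M * pearsonWeight σP σR p m z := by
  refine ⟨m + (m * σR ^ 2 + 2 * p) / σP ^ 2, by positivity, fun z => ?_⟩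
  rw [pearsonWeight_eq_mul_succ hσP (m := m), abs_mul, abs_of_nonneg (pearsonWeight_nonneg hσP _),
    ← mul_assoc]
  refine mul_le_mul_of_nonneg_right ?_ (pearsonWeight_nonneg hσP _)
  have h : (m + (m * σR ^ 2 + 2 * p) / σP ^ 2) * (σP ^ 2 + σR ^ 2 * z ^ 2) =
      m * σP ^ 2 + m * σR ^ 2 * z ^ 2 + m * σR ^ 2 + 2 * p +
        (m * σR ^ 2 + 2 * p) / σP ^ 2 * (σR ^ 2 * z ^ 2) := by
    field_simp
    ring
  rw [h]
  have h1 : 0 ≤ (m * σR ^ 2 + 2 * p) / σP ^ 2 * (σR ^ 2 * z ^ 2) := by positivity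
  have h2 : 0 ≤ m * σP ^ 2 := by positivity
  have h3 : 0 ≤ m * σR ^ 2 * (z - 1) ^ 2 := by positivity
  have h4 : 0 ≤ m * σR ^ 2 * (z + 1) ^ 2 := by positivity
  rw [abs_le]
  constructor <;> nlinarith

lemma hasDerivAt_weylIntegral (hσP : 0 < σP) (hσR : 0 < σR) (hp : 0 < p)
    (hm : 0 < m) (ha : 0 < a) (ham : a < 2 * m - 1) (x : ℝ) :
    HasDerivAt (weylIntegral σP σR p m a) (-a * weylIntegral σP σR p m (a - 1) x) x := by
  obtain ⟨C, hC, hb⟩ := exists_pearsonWeight_add_le hσP hσR hp hm x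
  obtain ⟨M, hM, hd⟩ := exists_abs_deriv_pearsonWeight_le hσP hσR hp hm
  have hmeas : Measurable (fun u : ℝ => u ^ a *
      (-(2 * m * σR ^ 2 * (x + u) + 2 * p) * pearsonWeight σP σR p (m + 1) (x + u))) := by
    have := (continuous_pearsonWeight (p := p) (m := m + 1) hσP hσR).measurable
    fun_prop
  obtain ⟨hint, hder⟩ := hasDerivAt_integral_of_dominated_loc_of_deriv_le
    (μ := volume.restrict (Ioi (0 : ℝ))) (x₀ := x) (s := Metric.ball x 1)
    (F := fun y u => u ^ a * pearsonWeight σP σR p m (y + u))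
    (F' := fun y u => u ^ a *
      (-(2 * m * σR ^ 2 * (y + u) + 2 * p) * pearsonWeight σP σR p (m + 1) (y + u)))
    (bound := fun u => M * C * (u ^ a * (1 + u ^ 2) ^ (-m)))
    (Metric.ball_mem_nhds x one_pos)
    (.of_forall fun y => aestronglyMeasurable_rpow_mul_pearsonWeight hσP hσR y)
    (integrableOn_rpow_mul_pearsonWeight hσP hσR hp hm (by linarith) ham x)
    hmeas.aestronglyMeasurable
    ((ae_restrict_iff' measurableSet_Ioi).2 (.of_forall fun u (hu : 0 < u) y hy => by
      rw [norm_mul, Real.norm_of_nonneg (Real.rpow_nonneg hu.le a), Real.norm_eq_abs]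
      calc _ ≤ u ^ a * (M * (C * (1 + u ^ 2) ^ (-m))) := by
            gcongr
            exact (hd _).trans (by gcongr; exact hb y hy u)
        _ = _ := by ring))
    ((integrableOn_rpow_mul_one_add_sq hm (by linarith) ham).const_mul (M * C))
    (.of_forall fun u y _ =>
      ((hasDerivAt_pearsonWeight hσP hσR (y + u)).comp_add_const y u).const_mul (u ^ a))
  refine hder.congr_deriv ?_
  have hint' := integrableOn_rpow_mul_pearsonWeight hσP hσR hp hm
    (by linarith : -1 < a - 1) (by linarith) x
  have h1 := (hint'.const_mul a).congr (.of_forall fun u => (mul_assoc a _ _).symm)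
  have h := integral_deriv_rpow_mul_pearsonWeight hσP hσR hp ha (by linarith) x (h1.add hint)
  rw [integral_add h1 hint] at h
  simp_rw [mul_assoc a, integral_const_mul] at h
  unfold weylIntegral
  linarith

/-- `weylIntegral` solves the second-order equation whose coefficients match the exponents. -/
lemma weylIntegral_ode (hσP : 0 < σP) (hσR : 0 < σR) (hp : 0 < p)
    {k α : ℝ} (hk : 0 < k) (hα : 0 < α) (x : ℝ) :
    (1 / 2) * (σP ^ 2 + σR ^ 2 * x ^ 2) *
        (-(α + 1) * (-α * weylIntegral σP σR p (α + k / 2 + 1) (α - 1) x)) +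
      (p + k * σR ^ 2 / 2 * x) * (-(α + 1) * weylIntegral σP σR p (α + k / 2 + 1) α x) =
    (α + 1) * (α + k) * σR ^ 2 / 2 * weylIntegral σP σR p (α + k / 2 + 1) (α + 1) x := by
  set m := α + k / 2 with hm
  have i0 := integrableOn_rpow_mul_pearsonWeight hσP hσR hp (m := m + 1) (a := α - 1)
    (by linarith) (by linarith) (by linarith) x
  have i1 := integrableOn_rpow_mul_pearsonWeight hσP hσR hp (m := m + 1) (a := α)
    (by linarith) (by linarith) (by linarith) x
  have i2 := integrableOn_rpow_mul_pearsonWeight hσP hσR hp (m := m + 1) (a := α + 1)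
    (by linarith) (by linarith) (by linarith) x
  have j0 := i0.const_mul (α * (σP ^ 2 + σR ^ 2 * x ^ 2))
  have j1 := i1.const_mul (-(2 * p + k * σR ^ 2 * x))
  have j2 := i2.const_mul (-((α + k) * σR ^ 2))
  have key : ∀ u ∈ Ioi (0 : ℝ),
      α * (σP ^ 2 + σR ^ 2 * x ^ 2) * (u ^ (α - 1) * pearsonWeight σP σR p (m + 1) (x + u)) +
        -(2 * p + k * σR ^ 2 * x) * (u ^ α * pearsonWeight σP σR p (m + 1) (x + u)) +
        -((α + k) * σR ^ 2) * (u ^ (α + 1) * pearsonWeight σP σR p (m + 1) (x + u)) =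
      α * u ^ (α - 1) * pearsonWeight σP σR p m (x + u) +
      u ^ α * (-(2 * m * σR ^ 2 * (x + u) + 2 * p) * pearsonWeight σP σR p (m + 1) (x + u)) := by
    intro u (hu : 0 < u)
    have e1 : u ^ α = u ^ (α - 1) * u := by
      rw [← Real.rpow_add_one hu.ne']
      congr 1
      ring
    rw [pearsonWeight_eq_mul_succ hσP (m := m), Real.rpow_add_one hu.ne', e1, hm]
    ring
  have h := integral_deriv_rpow_mul_pearsonWeight hσP hσR hp (m := m) hα (by linarith) x
    (IntegrableOn.congr_fun ((j0.add j1).add j2) key measurableSet_Ioi)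
  rw [← setIntegral_congr_fun measurableSet_Ioi key, integral_add (j0.fun_add j1) j2,
    integral_add j0 j1, integral_const_mul, integral_const_mul, integral_const_mul] at h
  unfold weylIntegral
  linear_combination (α + 1) / 2 * h

lemma arctan_image_Ioi (hσP : 0 < σP) (hσR : 0 < σR) (x : ℝ) :
    (fun u => Real.arctan (σR * (x + u) / σP)) '' Ioi 0 =
      Ioo (Real.arctan (σR * x / σP)) (Real.pi / 2) := by
  ext t
  constructor
  · rintro ⟨u, hu, rfl⟩
    refine ⟨Real.arctan_strictMono ?_, Real.arctan_lt_pi_div_two _⟩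
    have hu : 0 < u := hu
    gcongr
    linarith
  · rintro ⟨h1, h2⟩
    have h3 : -(Real.pi / 2) < t := (Real.neg_pi_div_two_lt_arctan _).trans h1
    have h4 : σR * x / σP < Real.tan t := by
      rwa [← Real.arctan_tan h3 h2, Real.arctan_lt_arctan_iff] at h1
    refine ⟨σP * Real.tan t / σR - x, ?_, ?_⟩
    · rw [div_lt_iff₀ hσP] at h4
      rw [mem_Ioi, sub_pos, lt_div_iff₀ hσR]
      linarith
    · have : σR * (x + (σP * Real.tan t / σR - x)) / σP = Real.tan t := by
        field_simp
        ring
      simp only [this, Real.arctan_tan h3 h2]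

/-- The substitution `t = arctan (σR (x + u) / σP)` turns `Dfun` into a `weylIntegral`. -/
lemma Dfun_eq_weylIntegral (hσP : 0 < σP) (hσR : 0 < σR) (β lam x : ℝ) :
    Dfun σP σR p β x lam = weylIntegral σP σR p (β / 2 + 1) lam x := by
  have hinj : InjOn (fun u => Real.arctan (σR * (x + u) / σP)) (Ioi 0) := by
    intro u _ v _ h
    have h := Real.arctan_injective h
    field_simp at h
    linarith
  have hderiv : ∀ u ∈ Ioi (0 : ℝ), HasDerivWithinAt
      (fun u => Real.arctan (σR * (x + u) / σP))
      (σP * σR / (σP ^ 2 + σR ^ 2 * (x + u) ^ 2)) (Ioi 0) u := by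
    intro u _
    have hQ := quadratic_pos (σR := σR) hσP (x + u)
    have h : HasDerivAt (fun u : ℝ => σR * (x + u) / σP) (σR / σP) u := by
      simpa using (((hasDerivAt_id u).const_add x).const_mul σR).div_const σP
    refine (h.arctan.congr_deriv ?_).hasDerivWithinAt
    field_simp
  rw [Dfun, intervalIntegral.integral_of_le (Real.arctan_lt_pi_div_two _).le,
    integral_Ioc_eq_integral_Ioo, ← arctan_image_Ioi hσP hσR,
    integral_image_eq_integral_abs_deriv_smul measurableSet_Ioi hderiv hinj,
    ← integral_const_mul, weylIntegral]
  refine setIntegral_congr_fun measurableSet_Ioi fun u (hu : 0 < u) => ?_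
  have hQ := quadratic_pos (σR := σR) hσP (x + u)
  set Q := σP ^ 2 + σR ^ 2 * (x + u) ^ 2 with hQdef
  set t := Real.arctan (σR * (x + u) / σP) with ht
  have hc : 0 < Real.cos t := Real.cos_arctan_pos _
  have hc2 : Real.cos t ^ 2 = σP ^ 2 / Q := by
    rw [ht, Real.cos_sq_arctan, hQdef]
    field_simp
  have hs : σP * Real.sin t - σR * x * Real.cos t = σR * u * Real.cos t := by
    have h := Real.tan_mul_cos hc.ne'
    rw [ht, Real.tan_arctan, ← ht] at h
    rw [← h]
    field_simp
    ring
  have hcβ : Real.cos t ^ β = σP ^ β * Q ^ (-(β / 2)) := by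
    have : Real.cos t ^ β = (Real.cos t ^ 2) ^ (β / 2) := by
      rw [← Real.rpow_natCast, ← Real.rpow_mul hc.le]
      congr 1
      push_cast
      ring
    rw [this, hc2, Real.div_rpow (by positivity) hQ.le, Real.rpow_neg hQ.le, ← Real.rpow_natCast,
      ← Real.rpow_mul hσP.le, div_eq_mul_inv]
    congr 2
    push_cast
    ring
  have hcl : Real.cos t ^ (β - lam) * Real.cos t ^ lam = Real.cos t ^ β := by
    rw [← Real.rpow_add hc]
    congr 1
    ring
  have hP : σP ^ (-(1 + β)) * (σP * σP ^ β) = 1 := by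
    rw [Real.rpow_neg hσP.le, Real.rpow_add hσP, Real.rpow_one]
    exact inv_mul_cancel₀ (by positivity)
  have hR : σR ^ (-(1 + lam)) * (σR * σR ^ lam) = 1 := by
    rw [Real.rpow_neg hσR.le, Real.rpow_add hσR, Real.rpow_one]
    exact inv_mul_cancel₀ (by positivity)
  simp only [smul_eq_mul]
  rw [hs, Real.mul_rpow (by positivity) hc.le, Real.mul_rpow hσR.le hu.le,
    abs_of_pos (by positivity), pearsonWeight, ← hQdef, ← ht]
  have hQ1 : Q ^ (-(β / 2 + 1)) = Q ^ (-(β / 2)) / Q := by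
    rw [← Real.rpow_sub_one hQ.ne']
    congr 1
    ring
  rw [hQ1]
  calc _ = σP ^ (-(1 + β)) * σP * (σR ^ (-(1 + lam)) * (σR * σR ^ lam)) *
        (Real.cos t ^ (β - lam) * Real.cos t ^ lam) / Q * u ^ lam *
        Real.exp (-2 * p * t / (σP * σR)) := by ring
    _ = (σP ^ (-(1 + β)) * (σP * σP ^ β)) * (Q ^ (-(β / 2)) / Q) * u ^ lam *
        Real.exp (-2 * p * t / (σP * σR)) := by rw [hcl, hcβ, hR]; ring
    _ = _ := by rw [hP]; ring

end

/-- `x ↦ D(x, α+1)` solves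
`½(σP² + σR² x²) D'' + (p + r x) D' = δ D` on all of `ℝ` (Example 3.2, `ρ = 0`). -/
theorem Dfun_solves_ODE
    (σP σR p r δ : ℝ)
    (hσP : 0 < σP) (hσR : 0 < σR) (hp : 0 < p) (hr : 0 < r) (hδ : r < δ)
    (β α : ℝ)
    (hβ : β = Real.sqrt ((2 * r / σR ^ 2 - 1) ^ 2 + 8 * δ / σR ^ 2) - 1)
    (hα : α = (Real.sqrt ((2 * r / σR ^ 2 - 1) ^ 2 + 8 * δ / σR ^ 2)
        - (1 + 2 * r / σR ^ 2)) / 2) :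
    0 < β ∧ 0 < α ∧
    (∀ x : ℝ, DifferentiableAt ℝ (fun y => Dfun σP σR p β y (α + 1)) x ∧
      DifferentiableAt ℝ (deriv (fun y => Dfun σP σR p β y (α + 1))) x) ∧
    ∀ x : ℝ,
      (1 / 2) * (σP ^ 2 + σR ^ 2 * x ^ 2) *
          deriv (deriv (fun y => Dfun σP σR p β y (α + 1))) x
        + (p + r * x) * deriv (fun y => Dfun σP σR p β y (α + 1)) x
        = δ * Dfun σP σR p β x (α + 1) := by
  have hσR2 : 0 < σR ^ 2 := by positivity
  obtain ⟨k, hk⟩ : ∃ k, k = 2 * r / σR ^ 2 := ⟨_, rfl⟩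
  have hk0 : 0 < k := by rw [hk]; positivity
  have hrk : r = k * σR ^ 2 / 2 := by rw [hk]; field_simp
  obtain ⟨d, hd⟩ : ∃ d, d = 8 * δ / σR ^ 2 := ⟨_, rfl⟩
  have hδd : δ = d * σR ^ 2 / 8 := by rw [hd]; field_simp
  have hkd : 4 * k < d := by
    have : r * 8 < δ * 8 := by linarith
    rw [hrk, hδd] at this
    nlinarith
  rw [← hk, ← hd] at hβ
  have hα' : α = (Real.sqrt ((k - 1) ^ 2 + d) - (1 + k)) / 2 := by
    rw [hα, ← hd, mul_div_assoc, ← mul_div_assoc, ← hk]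
  obtain ⟨s, hs⟩ : ∃ s, s = Real.sqrt ((k - 1) ^ 2 + d) := ⟨_, rfl⟩
  have hs2 : s ^ 2 = (k - 1) ^ 2 + d := by
    rw [hs, Real.sq_sqrt (by nlinarith)]
  have hsk : k + 1 < s := by
    rw [hs]
    exact Real.lt_sqrt_of_sq_lt (by nlinarith)
  rw [← hs] at hβ hα'
  have hα0 : 0 < α := by linarith
  have hm : β / 2 + 1 = α + k / 2 + 1 := by linarith
  have hδα : δ = (α + 1) * (α + k) * σR ^ 2 / 2 := by
    rw [hδd, hα']
    linear_combination -(σR ^ 2 / 8) * hs2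
  have hD : (fun y => Dfun σP σR p β y (α + 1)) =
      weylIntegral σP σR p (α + k / 2 + 1) (α + 1) := by
    funext y
    rw [Dfun_eq_weylIntegral hσP hσR, hm]
  have h1 (x : ℝ) : HasDerivAt (weylIntegral σP σR p (α + k / 2 + 1) (α + 1))
      (-(α + 1) * weylIntegral σP σR p (α + k / 2 + 1) α x) x := by
    simpa using hasDerivAt_weylIntegral hσP hσR hp (m := α + k / 2 + 1) (a := α + 1)
      (by linarith) (by linarith) (by linarith) x
  have hD' : deriv (weylIntegral σP σR p (α + k / 2 + 1) (α + 1)) =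
      fun x => -(α + 1) * weylIntegral σP σR p (α + k / 2 + 1) α x :=
    funext fun x => (h1 x).deriv
  have h2 (x : ℝ) : HasDerivAt (fun x => -(α + 1) * weylIntegral σP σR p (α + k / 2 + 1) α x)
      (-(α + 1) * (-α * weylIntegral σP σR p (α + k / 2 + 1) (α - 1) x)) x :=
    (hasDerivAt_weylIntegral hσP hσR hp (by linarith) hα0 (by linarith) x).const_mul _
  refine ⟨by linarith, hα0, fun x => ?_, fun x => ?_⟩
  · rw [hD, hD']
    exact ⟨(h1 x).differentiableAt, (h2 x).differentiableAt⟩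
  · rw [hD, hD', (h2 x).deriv, Dfun_eq_weylIntegral hσP hσR, hm, hrk, hδα]
    exact weylIntegral_ode hσP hσR hp hk0 hα0 x
end

section
/- Let σ_P, σ_R, p, r > 0 and δ > r. Set β = √((2r/σ_R² − 1)² + 8δ/σ_R²) − 1 and α = ½[√((2r/σ_R² − 1)² + 8δ/σ_R²) − (1 + 2r/σ_R²)] (so β > 0 and α > 0). Then the function x ↦ E(x, α+1) is twice differentiable on ℝ and satisfies ½(σ_P² + σ_R² x²) E''(x, α+1) + (p + r x) E'(x, α+1) = δ E(x, α+1) for all x ∈ ℝ, where derivatives are taken in the first variable. -/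
open Real Filter MeasureTheory Set

section PowerConvolution

variable {s lam C R : ℝ} {f f' : ℝ → ℝ}

lemma one_add_abs_sub_rpow_neg_le (hs : 0 ≤ s) (y v : ℝ) :
    (1 + |y - v|) ^ (-s) ≤ (1 + |y|) ^ s * (1 + |v|) ^ (-s) := by
  have h1 : 0 < 1 + |y - v| := by positivity
  have h2 : 0 < 1 + |y| := by positivity
  have h3 : 0 < 1 + |v| := by positivity
  have h4 : 1 + |v| ≤ (1 + |y|) * (1 + |y - v|) := by
    have := abs_sub_abs_le_abs_sub v y
    rw [abs_sub_comm v y] at this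
    nlinarith [abs_nonneg y, abs_nonneg (y - v), mul_nonneg (abs_nonneg y) (abs_nonneg (y - v))]
  have h5 := Real.rpow_le_rpow h3.le h4 hs
  rw [Real.mul_rpow h2.le h1.le] at h5
  rw [Real.rpow_neg h1.le, Real.rpow_neg h3.le, ← div_eq_mul_inv, inv_eq_one_div,
    div_le_div_iff₀ (by positivity) (by positivity)]
  linarith

lemma abs_rpow_mul_comp_sub_le (hs : 0 ≤ s) (hlam : 0 ≤ lam)
    (hf : ∀ u, |f u| ≤ C * (1 + |u|) ^ (-s)) {y v : ℝ} (hy : |y| ≤ R) (hv : 0 < v) :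
    |v ^ lam * f (y - v)| ≤ C * (1 + R) ^ s * (1 + ‖v‖) ^ (-(s - lam)) := by
  have hC : 0 ≤ C := by
    have := (abs_nonneg _).trans (hf 0)
    simpa using this
  have h1 : v ^ lam ≤ (1 + |v|) ^ lam :=
    Real.rpow_le_rpow hv.le (by linarith [le_abs_self v]) hlam
  have h2 : |f (y - v)| ≤ C * ((1 + R) ^ s * (1 + |v|) ^ (-s)) := by
    refine (hf _).trans (mul_le_mul_of_nonneg_left ?_ hC)
    refine (one_add_abs_sub_rpow_neg_le hs y v).trans ?_
    gcongr
  have h3 : (1 + |v|) ^ (-(s - lam)) = (1 + |v|) ^ lam * (1 + |v|) ^ (-s) := by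
    rw [← Real.rpow_add (by positivity)]
    congr 1
    ring
  have hR : 0 ≤ R := (abs_nonneg y).trans hy
  rw [abs_mul, abs_of_nonneg (Real.rpow_nonneg hv.le _), Real.norm_eq_abs, h3]
  calc v ^ lam * |f (y - v)|
      ≤ (1 + |v|) ^ lam * (C * ((1 + R) ^ s * (1 + |v|) ^ (-s))) := by gcongr
    _ = _ := by ring

lemma integrableOn_one_add_norm_rpow (A : ℝ) (h : lam + 1 < s) :
    Integrable (fun v : ℝ => A * (1 + ‖v‖) ^ (-(s - lam))) (volume.restrict (Ioi 0)) :=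
  ((integrable_one_add_norm (by simpa using by linarith)).const_mul A).restrict

lemma aestronglyMeasurable_rpow_mul_comp_sub (hfc : Continuous f) (hlam : 0 ≤ lam) (y : ℝ) :
    AEStronglyMeasurable (fun v => v ^ lam * f (y - v)) (volume.restrict (Ioi 0)) :=
  ((Real.continuous_rpow_const hlam).mul
    (hfc.comp (continuous_const.sub continuous_id))).aestronglyMeasurable

lemma integrableOn_rpow_mul_comp_sub (hlam : 0 ≤ lam) (h : lam + 1 < s) (hfc : Continuous f)
    (hf : ∀ u, |f u| ≤ C * (1 + |u|) ^ (-s)) (y : ℝ) :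
    IntegrableOn (fun v => v ^ lam * f (y - v)) (Ioi 0) := by
  refine (integrableOn_one_add_norm_rpow (C * (1 + |y|) ^ s) h).mono'
    (aestronglyMeasurable_rpow_mul_comp_sub hfc hlam y) ?_
  filter_upwards [ae_restrict_mem measurableSet_Ioi] with v hv
  exact abs_rpow_mul_comp_sub_le (by linarith) hlam hf le_rfl hv

lemma hasDerivAt_integral_rpow_mul_comp_sub (hlam : 0 ≤ lam) (h : lam + 1 < s)
    (hderiv : ∀ u, HasDerivAt f (f' u) u) (hf'c : Continuous f') {C' : ℝ}
    (hf : ∀ u, |f u| ≤ C * (1 + |u|) ^ (-s)) (hf' : ∀ u, |f' u| ≤ C' * (1 + |u|) ^ (-s))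
    (x : ℝ) :
    HasDerivAt (fun y => ∫ v in Ioi (0 : ℝ), v ^ lam * f (y - v))
      (∫ v in Ioi (0 : ℝ), v ^ lam * f' (x - v)) x := by
  have hfc : Continuous f := continuous_iff_continuousAt.2 fun u => (hderiv u).continuousAt
  refine (hasDerivAt_integral_of_dominated_loc_of_deriv_le
    (F := fun y v => v ^ lam * f (y - v)) (F' := fun y v => v ^ lam * f' (y - v))
    (Metric.ball_mem_nhds x one_pos)
    (Eventually.of_forall fun y => aestronglyMeasurable_rpow_mul_comp_sub hfc hlam y)
    (integrableOn_rpow_mul_comp_sub hlam h hfc hf x)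
    (aestronglyMeasurable_rpow_mul_comp_sub hf'c hlam x) ?_
    (integrableOn_one_add_norm_rpow (C' * (1 + (|x| + 1)) ^ s) h) ?_).2
  · filter_upwards [ae_restrict_mem measurableSet_Ioi] with v hv y hy
    refine abs_rpow_mul_comp_sub_le (by linarith) hlam hf' ?_ hv
    rw [Metric.mem_ball, Real.dist_eq] at hy
    linarith [abs_sub_abs_le_abs_sub y x]
  · refine Eventually.of_forall fun v y _ => ?_
    have := (hderiv (y - v)).comp y ((hasDerivAt_id y).sub_const v)
    simpa using this.const_mul (v ^ lam)

open scoped Topology in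
lemma tendsto_rpow_mul_comp_sub (hlam : 0 ≤ lam) (h : lam < s)
    (hf : ∀ u, |f u| ≤ C * (1 + |u|) ^ (-s)) (x : ℝ) :
    Tendsto (fun v => v ^ lam * f (x - v)) atTop (𝓝 0) := by
  have h1 : Tendsto (fun v : ℝ => C * (1 + |x|) ^ s * (1 + ‖v‖) ^ (-(s - lam))) atTop (𝓝 0) := by
    have h2 : Tendsto (fun v : ℝ => 1 + ‖v‖) atTop atTop :=
      tendsto_atTop_add_const_left _ _ tendsto_norm_atTop_atTop
    simpa using ((tendsto_rpow_neg_atTop (sub_pos.2 h)).comp h2).const_mul (C * (1 + |x|) ^ s)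
  refine squeeze_zero_norm' ?_ h1
  filter_upwards [eventually_gt_atTop 0] with v hv
  exact abs_rpow_mul_comp_sub_le (by linarith) hlam hf le_rfl hv

end PowerConvolution

/-- The unnormalised Pearson type IV density. -/
noncomputable def pearsonDensity (b k m u : ℝ) : ℝ :=
  (1 + (m * u) ^ 2) ^ (-b) * Real.exp (-k * Real.arctan (m * u))

/-- The logarithmic derivative of `pearsonDensity`. -/
noncomputable def pearsonScore (b k m u : ℝ) : ℝ :=
  -(2 * b * m ^ 2 * u + k * m) / (1 + (m * u) ^ 2)

/-- The derivative of `pearsonScore`. -/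
noncomputable def pearsonScoreDeriv (b k m u : ℝ) : ℝ :=
  -(2 * b * m ^ 2 + 2 * m ^ 2 * u * pearsonScore b k m u) / (1 + (m * u) ^ 2)

section Pearson

variable (b k m : ℝ)

lemma hasDerivAt_one_add_mul_sq (u : ℝ) :
    HasDerivAt (fun u => 1 + (m * u) ^ 2) (2 * m ^ 2 * u) u := by
  have h := (((hasDerivAt_id u).const_mul m).pow 2).const_add 1
  refine h.congr_deriv ?_
  simp
  ring

lemma hasDerivAt_pearsonDensity (u : ℝ) :
    HasDerivAt (pearsonDensity b k m) (pearsonScore b k m u * pearsonDensity b k m u) u := by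
  have hq : 0 < 1 + (m * u) ^ 2 := by positivity
  have h1 := (hasDerivAt_one_add_mul_sq m u).rpow_const (p := -b) (Or.inl hq.ne')
  have h2 := ((((hasDerivAt_id u).const_mul m).arctan).const_mul (-k)).exp
  refine (h1.mul h2).congr_deriv ?_
  simp only [id, pearsonScore, pearsonDensity]
  rw [Real.rpow_sub_one hq.ne']
  field_simp
  ring

lemma hasDerivAt_pearsonScore (u : ℝ) :
    HasDerivAt (pearsonScore b k m) (pearsonScoreDeriv b k m u) u := by
  have hq : 0 < 1 + (m * u) ^ 2 := by positivity
  have h1 := ((((hasDerivAt_id u).const_mul (2 * b * m ^ 2)).add_const (k * m)).neg).div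
    (hasDerivAt_one_add_mul_sq m u) hq.ne'
  refine h1.congr_deriv ?_
  simp only [id, pearsonScore, pearsonScoreDeriv, Pi.neg_apply]
  field_simp
  ring

lemma hasDerivAt_pearsonScore_mul_pearsonDensity (u : ℝ) :
    HasDerivAt (fun u => pearsonScore b k m u * pearsonDensity b k m u)
      ((pearsonScoreDeriv b k m u + pearsonScore b k m u ^ 2) * pearsonDensity b k m u) u := by
  refine ((hasDerivAt_pearsonScore b k m u).mul (hasDerivAt_pearsonDensity b k m u)).congr_deriv ?_
  ring

lemma continuous_pearsonDensity : Continuous (pearsonDensity b k m) :=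
  continuous_iff_continuousAt.2 fun u => (hasDerivAt_pearsonDensity b k m u).continuousAt

lemma continuous_pearsonScore : Continuous (pearsonScore b k m) :=
  continuous_iff_continuousAt.2 fun u => (hasDerivAt_pearsonScore b k m u).continuousAt

lemma continuous_pearsonScoreDeriv : Continuous (pearsonScoreDeriv b k m) := by
  have := continuous_pearsonScore b k m
  have hq : ∀ u : ℝ, 1 + (m * u) ^ 2 ≠ 0 := fun u => by positivity
  unfold pearsonScoreDeriv
  fun_prop (disch := exact hq _)

variable {b k m}

lemma pearsonDensity_nonneg (u : ℝ) : 0 ≤ pearsonDensity b k m u := by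
  unfold pearsonDensity
  positivity

lemma exists_pearsonDensity_le (hb : 0 ≤ b) (hk : 0 ≤ k) (hm : 0 < m) :
    ∃ C, ∀ u, |pearsonDensity b k m u| ≤ C * (1 + |u|) ^ (-(2 * b)) := by
  set c : ℝ := 2 + 2 / m ^ 2 with hc
  have hc0 : 0 < c := by positivity
  refine ⟨c ^ b * Real.exp (k * (π / 2)), fun u => ?_⟩
  rw [abs_of_nonneg (pearsonDensity_nonneg u), pearsonDensity]
  have h1 : (1 + |u|) ^ 2 / c ≤ 1 + (m * u) ^ 2 := by
    rw [div_le_iff₀ hc0]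
    have h : (1 + (m * u) ^ 2) * c = 2 + 2 * u ^ 2 + 2 / m ^ 2 + 2 * m ^ 2 * u ^ 2 := by
      rw [hc]
      field_simp
      ring
    rw [h]
    have : 0 < 2 / m ^ 2 := by positivity
    nlinarith [sq_nonneg (1 - |u|), sq_abs u, sq_nonneg (m * u)]
  have h2 : (1 + (m * u) ^ 2) ^ (-b) ≤ c ^ b * (1 + |u|) ^ (-(2 * b)) := by
    calc (1 + (m * u) ^ 2) ^ (-b) ≤ ((1 + |u|) ^ 2 / c) ^ (-b) :=
          Real.rpow_le_rpow_of_nonpos (by positivity) h1 (by linarith)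
      _ = c ^ b * (1 + |u|) ^ (-(2 * b)) := by
          rw [Real.div_rpow (by positivity) hc0.le, Real.rpow_neg hc0.le, div_inv_eq_mul, mul_comm,
            ← Real.rpow_natCast, ← Real.rpow_mul (by positivity)]
          congr 2
          push_cast
          ring
  have h3 : Real.exp (-k * Real.arctan (m * u)) ≤ Real.exp (k * (π / 2)) := by
    apply Real.exp_le_exp.2
    nlinarith [Real.neg_pi_div_two_lt_arctan (m * u)]
  calc _ ≤ c ^ b * (1 + |u|) ^ (-(2 * b)) * Real.exp (k * (π / 2)) := by gcongr
    _ = _ := by ring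

lemma exists_abs_pearsonScore_le (hb : 0 ≤ b) (hk : 0 ≤ k) (hm : 0 < m) :
    ∃ C, 0 ≤ C ∧ ∀ u, |pearsonScore b k m u| ≤ C * (1 + |u|) ^ (-1 : ℝ) := by
  refine ⟨b * m + 2 * b + k * m + k / 2, by positivity, fun u => ?_⟩
  have hq : 0 < 1 + (m * u) ^ 2 := by positivity
  have ha : 0 < 1 + |u| := by positivity
  rw [pearsonScore, abs_div, abs_neg, abs_of_pos hq, Real.rpow_neg_one, ← div_eq_mul_inv,
    div_le_div_iff₀ hq ha]
  have h1 : |2 * b * m ^ 2 * u + k * m| ≤ 2 * b * m ^ 2 * |u| + k * m := by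
    refine (abs_add_le _ _).trans (le_of_eq ?_)
    rw [abs_mul, abs_of_nonneg (by positivity : 0 ≤ 2 * b * m ^ 2),
      abs_of_nonneg (by positivity : 0 ≤ k * m)]
  refine (mul_le_mul_of_nonneg_right h1 ha.le).trans ?_
  have h2 : (m * u) ^ 2 = (m * |u|) ^ 2 := by rw [mul_pow, mul_pow, sq_abs]
  rw [h2]
  have h3 := sq_nonneg (1 - m * |u|)
  have h4 := mul_nonneg (mul_nonneg hb hm.le) h3
  have h5 := mul_nonneg hk h3
  have h6 : 0 ≤ k * m * (m * |u|) ^ 2 := by positivity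
  nlinarith

lemma exists_abs_pearsonScoreDeriv_le (hb : 0 ≤ b) (hk : 0 ≤ k) (hm : 0 < m) :
    ∃ C, ∀ u, |pearsonScoreDeriv b k m u| ≤ C := by
  obtain ⟨C, hC, h⟩ := exists_abs_pearsonScore_le hb hk hm
  refine ⟨2 * b * m ^ 2 + m * C, fun u => ?_⟩
  have hq : 0 < 1 + (m * u) ^ 2 := by positivity
  have hs : |pearsonScore b k m u| ≤ C := by
    refine (h u).trans (mul_le_of_le_one_right hC ?_)
    exact Real.rpow_le_one_of_one_le_of_nonpos (by linarith [abs_nonneg u]) (by norm_num)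
  rw [pearsonScoreDeriv, abs_div, abs_neg, abs_of_pos hq, div_le_iff₀ hq]
  have h1 : |2 * b * m ^ 2 + 2 * m ^ 2 * u * pearsonScore b k m u| ≤
      2 * b * m ^ 2 + 2 * m ^ 2 * |u| * C := by
    refine (abs_add_le _ _).trans ?_
    rw [abs_of_nonneg (by positivity : 0 ≤ 2 * b * m ^ 2), abs_mul, abs_mul,
      abs_of_nonneg (by positivity : 0 ≤ 2 * m ^ 2)]
    gcongr
  refine h1.trans ?_
  have h2 : (m * u) ^ 2 = (m * |u|) ^ 2 := by rw [mul_pow, mul_pow, sq_abs]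
  rw [h2]
  have h3 := mul_nonneg (mul_nonneg hm.le hC) (sq_nonneg (1 - m * |u|))
  have h4 : 0 ≤ 2 * b * m ^ 2 * (m * |u|) ^ 2 := by positivity
  nlinarith

lemma exists_abs_pearsonScore_mul_pearsonDensity_le (hb : 0 ≤ b) (hk : 0 ≤ k) (hm : 0 < m) :
    ∃ C, ∀ u, |pearsonScore b k m u * pearsonDensity b k m u| ≤
      C * (1 + |u|) ^ (-(2 * b + 1)) := by
  obtain ⟨C, hC⟩ := exists_pearsonDensity_le hb hk hm
  obtain ⟨C', hC'0, hC'⟩ := exists_abs_pearsonScore_le hb hk hm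
  refine ⟨C' * C, fun u => ?_⟩
  have h : (1 + |u|) ^ (-(2 * b + 1)) = (1 + |u|) ^ (-1 : ℝ) * (1 + |u|) ^ (-(2 * b)) := by
    rw [← Real.rpow_add (by positivity)]
    congr 1
    ring
  rw [abs_mul, h]
  calc _ ≤ (C' * (1 + |u|) ^ (-1 : ℝ)) * (C * (1 + |u|) ^ (-(2 * b))) :=
        mul_le_mul (hC' u) (hC u) (abs_nonneg _) (by positivity)
    _ = _ := by ring

lemma exists_abs_deriv_two_pearsonDensity_le (hb : 0 ≤ b) (hk : 0 ≤ k) (hm : 0 < m) :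
    ∃ C, ∀ u, |(pearsonScoreDeriv b k m u + pearsonScore b k m u ^ 2) * pearsonDensity b k m u| ≤
      C * (1 + |u|) ^ (-(2 * b)) := by
  obtain ⟨C, hC⟩ := exists_pearsonDensity_le hb hk hm
  obtain ⟨C', hC'0, hC'⟩ := exists_abs_pearsonScore_le hb hk hm
  obtain ⟨D, hD⟩ := exists_abs_pearsonScoreDeriv_le hb hk hm
  refine ⟨(D + C' ^ 2) * C, fun u => ?_⟩
  have hs : |pearsonScore b k m u| ≤ C' := by
    refine (hC' u).trans (mul_le_of_le_one_right hC'0 ?_)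
    exact Real.rpow_le_one_of_one_le_of_nonpos (by linarith [abs_nonneg u]) (by norm_num)
  have h1 : |pearsonScoreDeriv b k m u + pearsonScore b k m u ^ 2| ≤ D + C' ^ 2 := by
    refine (abs_add_le _ _).trans (add_le_add (hD u) ?_)
    rw [abs_pow]
    gcongr
  rw [abs_mul, mul_assoc]
  exact mul_le_mul h1 (hC u) (abs_nonneg _) ((abs_nonneg _).trans h1)

end Pearson

lemma image_arctan_mul_sub_Ioi {m : ℝ} (hm : 0 < m) (x : ℝ) :
    (fun v => Real.arctan (m * (x - v))) '' Ioi 0 = Ioo (-(π / 2)) (Real.arctan (m * x)) := by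
  ext t
  simp only [mem_image, mem_Ioi, mem_Ioo]
  constructor
  · rintro ⟨v, hv, rfl⟩
    exact ⟨Real.neg_pi_div_two_lt_arctan _, Real.arctan_strictMono (by nlinarith)⟩
  · rintro ⟨h1, h2⟩
    have h3 : t < π / 2 := h2.trans (Real.arctan_lt_pi_div_two _)
    have h4 : Real.tan t < m * x := by
      rw [← Real.arctan_tan h1 h3] at h2
      exact Real.arctan_strictMono.lt_iff_lt.1 h2
    refine ⟨x - Real.tan t / m, ?_, ?_⟩
    · rw [sub_pos, div_lt_iff₀ hm]
      linarith
    · rw [sub_sub_cancel, mul_div_cancel₀ _ hm.ne', Real.arctan_tan h1 h3]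

lemma integral_arctan_eq_integral_Ioi {m : ℝ} (hm : 0 < m) (x : ℝ) (g : ℝ → ℝ) :
    ∫ t in (-(π / 2))..Real.arctan (m * x), g t =
      ∫ v in Ioi (0 : ℝ), m / (1 + (m * (x - v)) ^ 2) * g (Real.arctan (m * (x - v))) := by
  have hderiv : ∀ v ∈ Ioi (0 : ℝ), HasDerivWithinAt (fun v => Real.arctan (m * (x - v)))
      (-(m / (1 + (m * (x - v)) ^ 2))) (Ioi 0) v := fun v _ => by
    refine ((((hasDerivAt_id v).const_sub x).const_mul m).arctan).hasDerivWithinAt.congr_deriv ?_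
    simp only [id]
    ring
  have hanti : AntitoneOn (fun v => Real.arctan (m * (x - v))) (Ioi 0) := fun v _ w _ hvw =>
    Real.arctan_strictMono.monotone (by nlinarith)
  rw [intervalIntegral.integral_of_le (Real.neg_pi_div_two_lt_arctan _).le,
    integral_Ioc_eq_integral_Ioo, ← image_arctan_mul_sub_Ioi hm x,
    integral_image_eq_integral_deriv_smul_of_antitoneOn measurableSet_Ioi hderiv hanti]
  simp

lemma Efun_eq_integral_Ioi {σP σR : ℝ} (hσP : 0 < σP) (hσR : 0 < σR) (p β lam x : ℝ) :
    Efun σP σR p β x lam =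
      σP ^ (-(1 + β)) * σR ^ (-(1 + lam)) * (σR / σP * σR ^ lam) *
        ∫ v in Ioi (0 : ℝ), v ^ lam *
          pearsonDensity (β / 2 + 1) (2 * p / (σP * σR)) (σR / σP) (x - v) := by
  have hm : 0 < σR / σP := by positivity
  have hx : σR * x / σP = σR / σP * x := by ring
  rw [Efun, hx, integral_arctan_eq_integral_Ioi hm, mul_assoc _ (σR / σP * σR ^ lam),
    ← integral_const_mul (σR / σP * σR ^ lam)]
  congr 1
  refine setIntegral_congr_fun measurableSet_Ioi fun v (hv : 0 < v) => ?_
  simp only [pearsonDensity]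
  set z := σR / σP * (x - v) with hz
  have hq : 0 < 1 + z ^ 2 := by positivity
  have hc := Real.cos_arctan_pos z
  have h1 : σR * x * Real.cos (Real.arctan z) - σP * Real.sin (Real.arctan z) =
      Real.cos (Real.arctan z) * (σR * v) := by
    have h : Real.sin (Real.arctan z) = z * Real.cos (Real.arctan z) := by
      rw [Real.sin_arctan, Real.cos_arctan]
      ring
    rw [h, hz]
    field_simp
    ring
  have h2 : Real.cos (Real.arctan z) ^ (β - lam) * Real.cos (Real.arctan z) ^ lam =
      (1 + z ^ 2) ^ (-(β / 2)) := by
    rw [← Real.rpow_add hc, Real.cos_arctan, one_div, Real.inv_rpow (Real.sqrt_nonneg _),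
      Real.sqrt_eq_rpow, ← Real.rpow_mul hq.le, Real.rpow_neg hq.le]
    congr 2
    ring
  have h3 : (1 + z ^ 2) ^ (-(β / 2 + 1)) = (1 + z ^ 2) ^ (-(β / 2)) / (1 + z ^ 2) := by
    rw [neg_add, ← sub_eq_add_neg, Real.rpow_sub_one hq.ne']
  have h4 : -2 * p * Real.arctan z / (σP * σR) = -(2 * p / (σP * σR)) * Real.arctan z := by ring
  rw [h1, Real.mul_rpow hc.le (by positivity), Real.mul_rpow hσR.le hv.le, h3, h4, ← h2]
  ring

open scoped Topology in
/-- The generator minus `δ`, applied to the translate of the Pearson density and weighted by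
`v ^ lam`, is a total derivative in `v`. -/
lemma integral_generator_eq_zero {σP σR p r δ β lam : ℝ} (hσP : 0 < σP) (hσR : 0 < σR)
    (hp : 0 < p) (hβ : 0 < β) (hlam : 0 < lam) (hlt : lam < β + 1)
    (hlamβ : σR ^ 2 * lam = σR ^ 2 * (β + 2) / 2 - r)
    (hquad : σR ^ 2 * lam * (lam - 1) / 2 + r * lam = δ) {w w1 w2 : ℝ → ℝ}
    (hw : w = pearsonDensity (β / 2 + 1) (2 * p / (σP * σR)) (σR / σP))
    (hw1 : w1 = fun u => pearsonScore (β / 2 + 1) (2 * p / (σP * σR)) (σR / σP) u * w u)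
    (hw2 : w2 = fun u => (pearsonScoreDeriv (β / 2 + 1) (2 * p / (σP * σR)) (σR / σP) u +
      pearsonScore (β / 2 + 1) (2 * p / (σP * σR)) (σR / σP) u ^ 2) * w u) (x : ℝ)
    (h0 : IntegrableOn (fun v => v ^ lam * w (x - v)) (Ioi 0))
    (h1 : IntegrableOn (fun v => v ^ lam * w1 (x - v)) (Ioi 0))
    (h2 : IntegrableOn (fun v => v ^ lam * w2 (x - v)) (Ioi 0)) :
    1 / 2 * (σP ^ 2 + σR ^ 2 * x ^ 2) * (∫ v in Ioi (0 : ℝ), v ^ lam * w2 (x - v)) +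
      (p + r * x) * (∫ v in Ioi (0 : ℝ), v ^ lam * w1 (x - v)) -
      δ * ∫ v in Ioi (0 : ℝ), v ^ lam * w (x - v) = 0 := by
  have hm : 0 < σR / σP := by positivity
  have hk : 0 ≤ 2 * p / (σP * σR) := by positivity
  have hb : 0 ≤ β / 2 + 1 := by positivity
  have hdw : ∀ u, HasDerivAt w (w1 u) u := by
    subst hw1 hw
    exact hasDerivAt_pearsonDensity _ _ _
  have hdw1 : ∀ u, HasDerivAt w1 (w2 u) u := by
    subst hw1 hw2 hw
    exact hasDerivAt_pearsonScore_mul_pearsonDensity _ _ _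
  have e1 : ∀ u, (σP ^ 2 + σR ^ 2 * u ^ 2) * w1 u = -((β + 2) * σR ^ 2 * u + 2 * p) * w u := by
    intro u
    have hq : σP ^ 2 + σR ^ 2 * u ^ 2 ≠ 0 := by positivity
    have hq' : 1 + (σR / σP * u) ^ 2 = (σP ^ 2 + σR ^ 2 * u ^ 2) / σP ^ 2 := by field_simp
    simp only [hw1, pearsonScore, hq']
    field_simp
  have e2 : ∀ u, (σP ^ 2 + σR ^ 2 * u ^ 2) * w2 u = -((β + 2) * σR ^ 2 * u + 2 * p) * w1 u -
      (β + 2) * σR ^ 2 * w u - 2 * σR ^ 2 * u * w1 u := by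
    intro u
    have hq : σP ^ 2 + σR ^ 2 * u ^ 2 ≠ 0 := by positivity
    have hq' : 1 + (σR / σP * u) ^ 2 = (σP ^ 2 + σR ^ 2 * u ^ 2) / σP ^ 2 := by field_simp
    simp only [hw1, hw2, pearsonScoreDeriv, pearsonScore, hq']
    field_simp
    ring
  set c : ℝ := -(σR ^ 2 * lam / 2 + r) with hc
  set F : ℝ → ℝ := fun v => -σR ^ 2 * x * (v ^ (lam + 1) * w1 (x - v)) +
    σR ^ 2 / 2 * (v ^ (lam + 2) * w1 (x - v)) + c * (v ^ (lam + 1) * w (x - v)) with hF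
  have hFderiv : ∀ v ∈ Ioi (0 : ℝ), HasDerivAt F
      (1 / 2 * (σP ^ 2 + σR ^ 2 * x ^ 2) * (v ^ lam * w2 (x - v)) +
        (p + r * x) * (v ^ lam * w1 (x - v)) - δ * (v ^ lam * w (x - v))) v := by
    intro v hv
    have hv : 0 < v := hv
    have d0 := (hdw (x - v)).comp v ((hasDerivAt_id v).const_sub x)
    have d1 := (hdw1 (x - v)).comp v ((hasDerivAt_id v).const_sub x)
    have p1 := Real.hasDerivAt_rpow_const (x := v) (p := lam + 1) (Or.inl hv.ne')
    have p2 := Real.hasDerivAt_rpow_const (x := v) (p := lam + 2) (Or.inl hv.ne')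
    refine ((((p1.mul d1).const_mul (-σR ^ 2 * x)).add ((p2.mul d1).const_mul (σR ^ 2 / 2))).add
      ((p1.mul d0).const_mul c)).congr_deriv ?_
    have q1 : v ^ (lam + 1) = v ^ lam * v := Real.rpow_add_one hv.ne' _
    have q2 : v ^ (lam + 2) = v ^ lam * v ^ 2 := by
      rw [Real.rpow_add hv]
      norm_num
    have q3 : lam + 2 - 1 = lam + 1 := by ring
    simp only [Function.comp_apply, add_sub_cancel_right, q3, q1, q2]
    have e1' := e1 (x - v)
    have e2' := e2 (x - v)
    rw [hc]
    generalize w (x - v) = W at *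
    generalize w1 (x - v) = W1 at *
    generalize w2 (x - v) = W2 at *
    generalize v ^ lam = V at *
    have hr : r = σR ^ 2 * (β + 2) / 2 - σR ^ 2 * lam := by linarith
    subst hquad hr
    linear_combination (-V / 2) * e2'
  have hcont : ContinuousWithinAt F (Ici 0) 0 := by
    have c0 : Continuous w := continuous_iff_continuousAt.2 fun u => (hdw u).continuousAt
    have c1 : Continuous w1 := continuous_iff_continuousAt.2 fun u => (hdw1 u).continuousAt
    have r1 : Continuous fun v : ℝ => v ^ (lam + 1) := Real.continuous_rpow_const (by linarith)
    have r2 : Continuous fun v : ℝ => v ^ (lam + 2) := Real.continuous_rpow_const (by linarith)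
    have : Continuous F := by fun_prop
    exact this.continuousWithinAt
  have hF0 : F 0 = 0 := by
    simp [hF, Real.zero_rpow (by linarith : lam + 1 ≠ 0), Real.zero_rpow (by linarith : lam + 2 ≠ 0)]
  have hFtop : Tendsto F atTop (𝓝 0) := by
    obtain ⟨C, hC⟩ := exists_pearsonDensity_le hb hk hm
    obtain ⟨C', hC'⟩ := exists_abs_pearsonScore_mul_pearsonDensity_le hb hk hm
    rw [← hw] at hC hC'
    replace hC' : ∀ u, |w1 u| ≤ C' * (1 + |u|) ^ (-(2 * (β / 2 + 1) + 1)) := by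
      rwa [hw1]
    have t1 := tendsto_rpow_mul_comp_sub (lam := lam + 1) (by linarith) (by linarith) hC' x
    have t2 := tendsto_rpow_mul_comp_sub (lam := lam + 2) (by linarith) (by linarith) hC' x
    have t0 := tendsto_rpow_mul_comp_sub (lam := lam + 1) (by linarith) (by linarith) hC x
    simpa using ((t1.const_mul (-σR ^ 2 * x)).add (t2.const_mul (σR ^ 2 / 2))).add (t0.const_mul c)
  have i2 := h2.const_mul (1 / 2 * (σP ^ 2 + σR ^ 2 * x ^ 2))
  have i1 := h1.const_mul (p + r * x)
  have i0 := h0.const_mul δ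
  have key := integral_Ioi_of_hasDerivAt_of_tendsto hcont hFderiv ((i2.add i1).sub i0) hFtop
  rw [hF0, sub_zero, integral_sub (by exact i2.add i1) i0, integral_add i2 i1, integral_const_mul,
    integral_const_mul, integral_const_mul] at key
  exact key

/-- `x ↦ E(x, α+1)` solves
`½(σP² + σR² x²) E'' + (p + r x) E' = δ E` on all of `ℝ` (Example 3.2, `ρ = 0`). -/
theorem Efun_solves_ODE
    (σP σR p r δ : ℝ)
    (hσP : 0 < σP) (hσR : 0 < σR) (hp : 0 < p) (hr : 0 < r) (hδ : r < δ)
    (β α : ℝ)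
    (hβ : β = Real.sqrt ((2 * r / σR ^ 2 - 1) ^ 2 + 8 * δ / σR ^ 2) - 1)
    (hα : α = (Real.sqrt ((2 * r / σR ^ 2 - 1) ^ 2 + 8 * δ / σR ^ 2)
        - (1 + 2 * r / σR ^ 2)) / 2) :
    0 < β ∧ 0 < α ∧
    (∀ x : ℝ, DifferentiableAt ℝ (fun y => Efun σP σR p β y (α + 1)) x ∧
      DifferentiableAt ℝ (deriv (fun y => Efun σP σR p β y (α + 1))) x) ∧
    ∀ x : ℝ,
      (1 / 2) * (σP ^ 2 + σR ^ 2 * x ^ 2) *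
          deriv (deriv (fun y => Efun σP σR p β y (α + 1))) x
        + (p + r * x) * deriv (fun y => Efun σP σR p β y (α + 1)) x
        = δ * Efun σP σR p β x (α + 1) := by
  set S := Real.sqrt ((2 * r / σR ^ 2 - 1) ^ 2 + 8 * δ / σR ^ 2) with hS
  set ρ := r / σR ^ 2 with hρ
  set d := δ / σR ^ 2 with hd
  have hρ0 : 0 < ρ := by positivity
  have hρd : ρ < d := by
    rw [hρ, hd]
    gcongr
  have e1 : 2 * r / σR ^ 2 = 2 * ρ := by rw [hρ]; ring
  have e2 : 8 * δ / σR ^ 2 = 8 * d := by rw [hd]; ring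
  have hr' : r = σR ^ 2 * ρ := by rw [hρ]; field_simp
  have hδ' : δ = σR ^ 2 * d := by rw [hd]; field_simp
  rw [e1, e2] at hS
  rw [e1] at hα
  have hSsq : S ^ 2 = (2 * ρ - 1) ^ 2 + 8 * d := by
    rw [hS, Real.sq_sqrt (by nlinarith [sq_nonneg (2 * ρ - 1)])]
  have hSpos : 0 ≤ S := Real.sqrt_nonneg _
  have hS1 : 1 + 2 * ρ < S := by nlinarith
  have hβ0 : 0 < β := by linarith
  have hα0 : 0 < α := by linarith
  have hlt : α + 1 < β + 1 := by linarith
  refine ⟨hβ0, hα0, ?_⟩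
  have hm : 0 < σR / σP := by positivity
  have hk : 0 ≤ 2 * p / (σP * σR) := by positivity
  have hb : 0 ≤ β / 2 + 1 := by positivity
  set b := β / 2 + 1 with hbdef
  set k := 2 * p / (σP * σR)
  set m := σR / σP
  obtain ⟨C0, hC0⟩ := exists_pearsonDensity_le hb hk hm
  obtain ⟨C1, hC1⟩ := exists_abs_pearsonScore_mul_pearsonDensity_le hb hk hm
  obtain ⟨C2, hC2⟩ := exists_abs_deriv_two_pearsonDensity_le hb hk hm
  have hC1' : ∀ u, |pearsonScore b k m u * pearsonDensity b k m u| ≤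
      C1 * (1 + |u|) ^ (-(2 * b)) := by
    have hC1n : 0 ≤ C1 := by
      have := (abs_nonneg _).trans (hC1 0)
      simpa using this
    refine fun u => (hC1 u).trans ?_
    gcongr
    · linarith [abs_nonneg u]
    · linarith
  have hlam : 0 ≤ α + 1 := by linarith
  have hs : α + 1 + 1 < 2 * b := by linarith
  have hc0 := continuous_pearsonDensity b k m
  have hc1 := (continuous_pearsonScore b k m).mul hc0
  have hc2 := ((continuous_pearsonScoreDeriv b k m).add
    ((continuous_pearsonScore b k m).pow 2)).mul hc0
  have D1 := hasDerivAt_integral_rpow_mul_comp_sub hlam hs (hasDerivAt_pearsonDensity b k m)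
    hc1 hC0 hC1'
  have D2 := hasDerivAt_integral_rpow_mul_comp_sub hlam hs
    (hasDerivAt_pearsonScore_mul_pearsonDensity b k m) hc2 hC1' hC2
  set K := σP ^ (-(1 + β)) * σR ^ (-(1 + (α + 1))) * (m * σR ^ (α + 1)) with hK
  have hE := funext fun y => Efun_eq_integral_Ioi hσP hσR p β (α + 1) y
  have hE1 : ∀ x, HasDerivAt (fun y => Efun σP σR p β y (α + 1)) _ x := fun x => by
    rw [hE]
    exact (D1 x).const_mul K
  have hE' := funext fun x => (hE1 x).deriv
  have hE2 : ∀ x, HasDerivAt (deriv fun y => Efun σP σR p β y (α + 1)) _ x := fun x => by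
    rw [hE']
    exact (D2 x).const_mul K
  refine ⟨fun x => ⟨(hE1 x).differentiableAt, (hE2 x).differentiableAt⟩, fun x => ?_⟩
  rw [(hE2 x).deriv, (hE1 x).deriv, Efun_eq_integral_Ioi hσP hσR]
  have key := integral_generator_eq_zero (r := r) (δ := δ) (lam := α + 1) hσP hσR hp hβ0
    (by linarith) hlt (by rw [hr', hα, hβ]; ring)
    (by rw [hr', hδ', hα]; linear_combination (σR ^ 2 / 8) * hSsq) rfl rfl rfl x
    (integrableOn_rpow_mul_comp_sub hlam hs hc0 hC0 x)
    (integrableOn_rpow_mul_comp_sub hlam hs hc1 hC1' x)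
    (integrableOn_rpow_mul_comp_sub hlam hs hc2 hC2 x)
  linear_combination K * key
end

section
/- Let σ_P, σ_R, p, r > 0 and δ > 0, and let β = √((2r/σ_R² − 1)² + 8δ/σ_R²) − 1. For every λ with 1 < λ < β + 1 and every y ∈ ℝ, the function y ↦ D(y, λ) is differentiable at y and its derivative equals −λ D(y, λ−1), i.e. ∂/∂y D(y, λ) = −λ D(y, λ−1). -/
open Real Filter MeasureTheory Set

open scoped Topology

theorem hasDerivAt_max_zero_rpow {s : ℝ} (hs : 1 < s) (z : ℝ) :
    HasDerivAt (fun w : ℝ => max 0 w ^ s) (s * max 0 z ^ (s - 1)) z := by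
  rcases lt_trichotomy z 0 with hz | rfl | hz
  · have h : (fun w : ℝ => max 0 w ^ s) =ᶠ[𝓝 z] fun _ => 0 := by
      filter_upwards [Iio_mem_nhds hz] with w hw
      rw [max_eq_left (le_of_lt hw), Real.zero_rpow (by linarith)]
    rw [max_eq_left hz.le, Real.zero_rpow (by linarith), mul_zero]
    exact (hasDerivAt_const z (0 : ℝ)).congr_of_eventuallyEq h
  · rw [max_self, Real.zero_rpow (by linarith), mul_zero, ← hasDerivWithinAt_univ,
      ← Iic_union_Ici (a := (0 : ℝ))]
    refine HasDerivWithinAt.union ?_ ?_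
    · refine (hasDerivWithinAt_const 0 _ (0 : ℝ)).congr (fun w hw => ?_) ?_
      · rw [max_eq_left hw, Real.zero_rpow (by linarith)]
      · rw [max_self, Real.zero_rpow (by linarith)]
    · have h := (Real.hasDerivAt_rpow_const (x := 0) (p := s) (Or.inr hs.le)).hasDerivWithinAt
        (s := Ici 0)
      rw [Real.zero_rpow (by linarith), mul_zero] at h
      refine h.congr (fun w hw => ?_) ?_
      · rw [max_eq_right hw]
      · rw [max_self]
  · have h : (fun w : ℝ => max 0 w ^ s) =ᶠ[𝓝 z] fun w => w ^ s := by
      filter_upwards [Ioi_mem_nhds hz] with w hw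
      rw [max_eq_right (le_of_lt hw)]
    rw [max_eq_right hz.le]
    exact (Real.hasDerivAt_rpow_const (Or.inr hs.le)).congr_of_eventuallyEq h

theorem integrableOn_cos_rpow {s : ℝ} (hs : -1 < s) :
    IntegrableOn (fun t => Real.cos t ^ s) (Ioo (-(π / 2)) (π / 2)) := by
  have hπ := Real.pi_pos
  have hle : -(π / 2) ≤ π / 2 := by linarith
  have h₁ : IntegrableOn (fun t : ℝ => (π / 2 - t) ^ s) (Ioo (-(π / 2)) (π / 2)) := by
    rw [← intervalIntegrable_iff_integrableOn_Ioo_of_le hle]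
    have h := (intervalIntegral.intervalIntegrable_rpow' (a := π) (b := 0) hs).comp_sub_left (π / 2)
    rw [sub_zero, show π / 2 - π = -(π / 2) by ring] at h
    exact h
  have h₂ : IntegrableOn (fun t : ℝ => (t + π / 2) ^ s) (Ioo (-(π / 2)) (π / 2)) := by
    rw [← intervalIntegrable_iff_integrableOn_Ioo_of_le hle]
    have h := (intervalIntegral.intervalIntegrable_rpow' (a := 0) (b := π) hs).comp_add_right
      (π / 2)
    rw [zero_sub, show π - π / 2 = π / 2 by ring] at h
    exact h
  have hone : IntegrableOn (fun _ : ℝ => (1 : ℝ)) (Ioo (-(π / 2)) (π / 2)) :=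
    integrableOn_const (by simp)
  have hsum := (hone.add (h₁.const_mul ((2 / π) ^ s))).add (h₂.const_mul ((2 / π) ^ s))
  refine Integrable.mono' hsum (Measurable.aestronglyMeasurable (by fun_prop)) ?_
  filter_upwards [ae_restrict_mem measurableSet_Ioo] with t ht
  have hu : 0 < π / 2 - t := by linarith [ht.2]
  have hv : 0 < t + π / 2 := by linarith [ht.1]
  have hc : 0 < Real.cos t := Real.cos_pos_of_mem_Ioo ht
  have hk : 0 < 2 / π := by positivity
  have pu : 0 < (2 / π) ^ s * (π / 2 - t) ^ s := by positivity
  have pv : 0 < (2 / π) ^ s * (t + π / 2) ^ s := by positivity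
  rw [Real.norm_of_nonneg (by positivity)]
  simp only [Pi.add_apply]
  rcases le_or_gt 0 s with h0 | h0
  · have := Real.rpow_le_one hc.le (Real.cos_le_one t) h0
    linarith
  · rcases le_total 0 t with h | h
    · have hb := Real.one_sub_mul_le_cos h ht.2.le
      have : Real.cos t ^ s ≤ (2 / π * (π / 2 - t)) ^ s := by
        refine Real.rpow_le_rpow_of_nonpos (by positivity) ?_ h0.le
        convert hb using 1
        field_simp
      rw [Real.mul_rpow hk.le hu.le] at this
      linarith
    · have hb := Real.one_add_mul_le_cos ht.1.le h
      have : Real.cos t ^ s ≤ (2 / π * (t + π / 2)) ^ s := by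
        refine Real.rpow_le_rpow_of_nonpos (by positivity) ?_ h0.le
        convert hb using 1
        field_simp
        ring
      rw [Real.mul_rpow hk.le hv.le] at this
      linarith

/-- The integral in `Dfun` may be taken over the fixed interval `(-π/2, π/2)` once the base of the
power is replaced by its positive part. -/
theorem Dfun_eq_setIntegral {σP : ℝ} (hσP : 0 < σP) (σR p β x : ℝ) {lam : ℝ} (hlam : 0 < lam) :
    Dfun σP σR p β x lam = σP ^ (-(1 + β)) * σR ^ (-(1 + lam)) *
      ∫ t in Ioo (-(π / 2)) (π / 2),
        Real.cos t ^ (β - lam) * max 0 (σP * Real.sin t - σR * x * Real.cos t) ^ lam *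
          Real.exp (-2 * p * t / (σP * σR)) := by
  set a := Real.arctan (σR * x / σP) with ha
  have ha' : a ∈ Ioo (-(π / 2)) (π / 2) := Real.arctan_mem_Ioo _
  have key : ∀ t ∈ Ioo (-(π / 2)) (π / 2),
      (a < t ↔ 0 < σP * Real.sin t - σR * x * Real.cos t) := by
    intro t ht
    have hc : 0 < Real.cos t := Real.cos_pos_of_mem_Ioo ht
    rw [← Real.strictMonoOn_tan.lt_iff_lt ha' ht, ha, Real.tan_arctan, Real.tan_eq_sin_div_cos,
      div_lt_div_iff₀ hσP hc, sub_pos, mul_comm (Real.sin t)]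
  rw [Dfun, intervalIntegral.integral_of_le ha'.2.le, integral_Ioc_eq_integral_Ioo]
  congr 1
  rw [setIntegral_eq_of_subset_of_forall_sdiff_eq_zero measurableSet_Ioo
    (Ioo_subset_Ioo_left ha'.1.le : Ioo a (π / 2) ⊆ Ioo (-(π / 2)) (π / 2))]
  · refine setIntegral_congr_fun measurableSet_Ioo fun t ht => ?_
    have h := (key t ⟨ha'.1.trans ht.1, ht.2⟩).1 ht.1
    simp only [max_eq_right h.le]
  · intro t ht
    have h : ¬ a < t := fun h => ht.2 ⟨h, ht.1.2⟩
    rw [key t ht.1, not_lt] at h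
    rw [max_eq_left h, Real.zero_rpow hlam.ne', mul_zero, zero_mul]

/-- The derivative identity `∂/∂y D(y, λ) = -λ D(y, λ-1)`
for `1 < λ < β + 1` (used in Example 4.2 of Yin–Wen). -/
theorem deriv_Dfun
    (σP σR p r δ : ℝ)
    (hσP : 0 < σP) (hσR : 0 < σR) (hp : 0 < p) (hr : 0 < r) (hδ : 0 < δ)
    (β : ℝ)
    (hβ : β = Real.sqrt ((2 * r / σR ^ 2 - 1) ^ 2 + 8 * δ / σR ^ 2) - 1) :
    ∀ lam : ℝ, 1 < lam → lam < β + 1 → ∀ y : ℝ,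
      HasDerivAt (fun x => Dfun σP σR p β x lam)
        (-lam * Dfun σP σR p β y (lam - 1)) y := by
  intro lam h1 h2 y
  have hexp : Continuous fun t : ℝ => Real.exp (-2 * p * t / (σP * σR)) := by fun_prop
  obtain ⟨M, hM⟩ := isCompact_Icc.exists_bound_of_continuousOn
    (s := Icc (-(π / 2)) (π / 2)) hexp.continuousOn
  set K : ℝ := σP + σR * (|y| + 1) with hK
  have hK0 : 0 < K := by positivity
  have hbase : ∀ x ∈ Metric.ball y 1, ∀ t ∈ Ioo (-(π / 2)) (π / 2),
      max 0 (σP * Real.sin t - σR * x * Real.cos t) ≤ K := by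
    intro x hx t ht
    have hc : 0 < Real.cos t := Real.cos_pos_of_mem_Ioo ht
    have hx' : |x| ≤ |y| + 1 := by
      have := abs_sub_abs_le_abs_sub x y
      rw [Metric.mem_ball, Real.dist_eq] at hx
      linarith
    refine max_le hK0.le ?_
    have e1 : σP * Real.sin t ≤ σP := mul_le_of_le_one_right hσP.le (Real.sin_le_one t)
    have e2 : -x * Real.cos t ≤ |y| + 1 :=
      calc -x * Real.cos t ≤ |x| * 1 :=
            mul_le_mul (neg_le_abs x) (Real.cos_le_one t) hc.le (abs_nonneg x)
        _ ≤ |y| + 1 := by linarith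
    have e3 := mul_le_mul_of_nonneg_left e2 hσR.le
    rw [hK]
    linarith
  let F : ℝ → ℝ → ℝ := fun x t =>
    Real.cos t ^ (β - lam) * max 0 (σP * Real.sin t - σR * x * Real.cos t) ^ lam *
      Real.exp (-2 * p * t / (σP * σR))
  let G : ℝ → ℝ → ℝ := fun x t =>
    -lam * σR * (Real.cos t ^ (β - (lam - 1)) *
      max 0 (σP * Real.sin t - σR * x * Real.cos t) ^ (lam - 1) *
      Real.exp (-2 * p * t / (σP * σR)))
  have hF : ∀ x, Measurable (F x) := fun x => by fun_prop
  have hG : ∀ x, Measurable (G x) := fun x => by fun_prop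
  have main := hasDerivAt_integral_of_dominated_loc_of_deriv_le
    (μ := volume.restrict (Ioo (-(π / 2)) (π / 2))) (F := F) (F' := G) (x₀ := y)
    (bound := fun _ => lam * σR * (K ^ (lam - 1) * M))
    (Metric.ball_mem_nhds y one_pos)
    (Eventually.of_forall fun x => (hF x).aestronglyMeasurable) ?_
    (hG y).aestronglyMeasurable ?_ (integrableOn_const (by simp)) ?_
  · have h := main.2.const_mul (σP ^ (-(1 + β)) * σR ^ (-(1 + lam)))
    simp_rw [Dfun_eq_setIntegral hσP σR p β _ (show 0 < lam by linarith)]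
    convert! h using 1
    rw [Dfun_eq_setIntegral hσP σR p β y (show 0 < lam - 1 by linarith), integral_const_mul,
      show -(1 + (lam - 1)) = -(1 + lam) + 1 by ring, Real.rpow_add_one hσR.ne']
    ring
  · refine Integrable.mono' ((integrableOn_cos_rpow (s := β - lam) (by linarith)).mul_const
      (K ^ lam * M)) (hF y).aestronglyMeasurable ?_
    filter_upwards [ae_restrict_mem measurableSet_Ioo] with t ht
    have hc : 0 < Real.cos t := Real.cos_pos_of_mem_Ioo ht
    have hm : 0 ≤ max 0 (σP * Real.sin t - σR * y * Real.cos t) := le_max_left _ _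
    have hb := Real.rpow_le_rpow hm (hbase y (Metric.mem_ball_self one_pos) t ht)
      (show 0 ≤ lam by linarith)
    have he := hM t (Ioo_subset_Icc_self ht)
    simp only [F]
    rw [Real.norm_of_nonneg (by positivity), mul_assoc]
    rw [Real.norm_of_nonneg (by positivity)] at he
    gcongr
  · filter_upwards [ae_restrict_mem measurableSet_Ioo] with t ht x hx
    have hc : 0 < Real.cos t := Real.cos_pos_of_mem_Ioo ht
    have hm : 0 ≤ max 0 (σP * Real.sin t - σR * x * Real.cos t) := le_max_left _ _
    have hb := Real.rpow_le_rpow hm (hbase x hx t ht) (show 0 ≤ lam - 1 by linarith)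
    have he := hM t (Ioo_subset_Icc_self ht)
    have hcos := Real.rpow_le_one hc.le (Real.cos_le_one t) (show 0 ≤ β - (lam - 1) by linarith)
    have hlam : 0 < lam := by linarith
    rw [Real.norm_of_nonneg (by positivity)] at he
    simp only [G]
    rw [norm_mul, neg_mul, norm_neg, Real.norm_of_nonneg (by positivity),
      Real.norm_of_nonneg (by positivity), mul_assoc (Real.cos t ^ _)]
    refine mul_le_mul_of_nonneg_left ?_ (by positivity)
    refine (mul_le_of_le_one_left (by positivity) hcos).trans ?_
    gcongr
  · filter_upwards [ae_restrict_mem measurableSet_Ioo] with t ht x _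
    have hc : 0 < Real.cos t := Real.cos_pos_of_mem_Ioo ht
    have hin : HasDerivAt (fun x => σP * Real.sin t - σR * x * Real.cos t)
        (-(σR * Real.cos t)) x := by
      simpa using (((hasDerivAt_id x).const_mul σR).mul_const (Real.cos t)).const_sub
        (σP * Real.sin t)
    have h := (((hasDerivAt_max_zero_rpow h1 _).comp x hin).const_mul
      (Real.cos t ^ (β - lam))).mul_const (Real.exp (-2 * p * t / (σP * σR)))
    convert! h using 1
    simp only [G]
    rw [show β - (lam - 1) = β - lam + 1 by ring, Real.rpow_add_one hc.ne']
    ring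
end

section
/- Let σ_P, σ_R, p, r > 0 and δ > 0, and let β = √((2r/σ_R² − 1)² + 8δ/σ_R²) − 1. For every λ with 1 < λ < β + 1 and every y ∈ ℝ, the function y ↦ E(y, λ) is differentiable at y and its derivative equals λ E(y, λ−1), i.e. ∂/∂y E(y, λ) = λ E(y, λ−1). -/
open Real Filter MeasureTheory Set

theorem hasDerivAt_max_zero_rpow_s6 {l : ℝ} (hl : 1 < l) (u : ℝ) :
    HasDerivAt (fun v : ℝ => max 0 v ^ l) (l * max 0 u ^ (l - 1)) u := by
  refine hasDerivAt_of_hasDerivAt_of_ne' (f := fun v : ℝ => max 0 v ^ l)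
    (g := fun v : ℝ => l * max 0 v ^ (l - 1)) (x := 0) ?_ ?_ ?_ u
  · intro v hv
    rcases lt_or_gt_of_ne hv with h | h
    · have h0 : l * max 0 v ^ (l - 1) = 0 := by
        rw [max_eq_left h.le, zero_rpow (by linarith), mul_zero]
      rw [h0]
      refine (hasDerivAt_const v (0 : ℝ)).congr_of_eventuallyEq ?_
      filter_upwards [Iio_mem_nhds h] with w hw
      rw [max_eq_left (le_of_lt hw), zero_rpow (by linarith)]
    · rw [max_eq_right h.le]
      refine (Real.hasDerivAt_rpow_const (Or.inl h.ne')).congr_of_eventuallyEq ?_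
      filter_upwards [Ioi_mem_nhds h] with w hw
      rw [max_eq_right (le_of_lt hw)]
  · exact ((continuous_const.max continuous_id).rpow_const
      fun _ => Or.inr (by linarith)).continuousAt
  · exact (continuous_const.mul ((continuous_const.max continuous_id).rpow_const
      fun _ => Or.inr (by linarith))).continuousAt

theorem intervalIntegrable_cos_rpow {s : ℝ} (hs : -1 < s) :
    IntervalIntegrable (fun t => cos t ^ s) volume (-(π / 2)) (π / 2) := by
  rcases le_or_gt 0 s with h | h
  · exact (continuous_cos.rpow_const fun _ => Or.inr h).intervalIntegrable _ _
  have hpi := Real.pi_pos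
  have right : IntervalIntegrable (fun t => cos t ^ s) volume 0 (π / 2) := by
    have hlin : IntervalIntegrable (fun t : ℝ => (1 - 2 / π * t) ^ s) volume 0 (π / 2) := by
      have h1 := ((intervalIntegral.intervalIntegrable_rpow' (a := 1) (b := 0) hs).comp_sub_left
        1).comp_mul_left (c := 2 / π)
      convert h1 using 1 <;> simp
    refine hlin.mono_fun' (measurable_cos.pow_const s).aestronglyMeasurable ?_
    rw [uIoc_of_le (by positivity)]
    have hne : ∀ᵐ t ∂(volume.restrict (Ioc 0 (π / 2))), t ≠ π / 2 :=
      ae_restrict_of_ae (Measure.ae_ne volume _)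
    filter_upwards [hne, ae_restrict_mem measurableSet_Ioc] with t ht htm
    have hlt : t < π / 2 := lt_of_le_of_ne htm.2 ht
    have hpos : 0 < 1 - 2 / π * t := by
      have : 2 / π * t < 2 / π * (π / 2) := by gcongr
      have h2 : 2 / π * (π / 2) = 1 := by field_simp
      linarith
    have hcos := one_sub_mul_le_cos htm.1.le htm.2
    rw [norm_of_nonneg (rpow_nonneg (hpos.le.trans hcos) _)]
    exact rpow_le_rpow_of_nonpos hpos hcos h.le
  have left : IntervalIntegrable (fun t => cos t ^ s) volume (-(π / 2)) 0 := by
    rw [← neg_zero]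
    simpa using ((IntervalIntegrable.iff_comp_neg (by finiteness)).1 right).symm
  exact left.trans right

/-- The integrand of `Efun`, extended by zero past the upper limit of integration. -/
noncomputable def Ekernel (σP σR p β lam x t : ℝ) : ℝ :=
  cos t ^ (β - lam) * max 0 (σR * x * cos t - σP * sin t) ^ lam * exp (-2 * p * t / (σP * σR))

theorem measurable_Ekernel (σP σR p β lam x : ℝ) : Measurable (Ekernel σP σR p β lam x) := by
  unfold Ekernel
  fun_prop

theorem intervalIntegrable_Ekernel (σP σR p : ℝ) {β lam : ℝ} (h0 : 0 ≤ lam) (hlam : lam < β + 1)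
    (x : ℝ) :
    IntervalIntegrable (Ekernel σP σR p β lam x) volume (-(π / 2)) (π / 2) := by
  unfold Ekernel
  refine ((intervalIntegrable_cos_rpow (by linarith)).mul_continuousOn ?_).mul_continuousOn ?_
  · exact (Continuous.rpow_const (by fun_prop) fun _ => Or.inr h0).continuousOn
  · exact Continuous.continuousOn (by fun_prop)

theorem Efun_eq_integral_Ekernel {σP σR p β lam : ℝ} (hσP : 0 < σP) (h0 : 0 < lam)
    (hlam : lam < β + 1) (x : ℝ) :
    Efun σP σR p β x lam = σP ^ (-(1 + β)) * σR ^ (-(1 + lam)) *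
      ∫ t in (-(π / 2))..(π / 2), Ekernel σP σR p β lam x t := by
  unfold Efun
  congr 1
  set a := arctan (σR * x / σP) with ha
  have ha1 : -(π / 2) < a := neg_pi_div_two_lt_arctan _
  have ha2 : a < π / 2 := arctan_lt_pi_div_two _
  have hca : 0 < cos a := cos_pos_of_mem_Ioo ⟨ha1, ha2⟩
  have key (t : ℝ) : σR * x * cos t - σP * sin t = σP / cos a * sin (a - t) := by
    have htan : sin a / cos a = σR * x / σP := by rw [← tan_eq_sin_div_cos, ha, tan_arctan]
    rw [div_eq_div_iff hca.ne' hσP.ne'] at htan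
    rw [sin_sub]
    field_simp
    linear_combination (-cos t) * htan
  have hpos : 0 < σP / cos a := div_pos hσP hca
  have hint := intervalIntegrable_Ekernel σP σR p h0.le hlam x
  have hmem : a ∈ uIcc (-(π / 2)) (π / 2) := by
    rw [uIcc_of_le (by linarith)]
    exact ⟨ha1.le, ha2.le⟩
  rw [← intervalIntegral.integral_add_adjacent_intervals
    (hint.mono_set (uIcc_subset_uIcc left_mem_uIcc hmem))
    (hint.mono_set (uIcc_subset_uIcc hmem right_mem_uIcc))]
  have hzero : ∫ t in a..(π / 2), Ekernel σP σR p β lam x t = 0 := by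
    refine intervalIntegral.integral_zero_ae (ae_of_all _ fun t ht => ?_)
    rw [uIoc_of_le ha2.le] at ht
    have hsin : sin (a - t) ≤ 0 :=
      sin_nonpos_of_nonpos_of_neg_pi_le (by linarith [ht.1]) (by linarith [ht.2])
    have hnonpos := mul_nonpos_of_nonneg_of_nonpos hpos.le hsin
    rw [Ekernel, key, max_eq_left hnonpos, zero_rpow h0.ne', mul_zero, zero_mul]
  rw [hzero, add_zero]
  refine intervalIntegral.integral_congr fun t ht => ?_
  rw [uIcc_of_le ha1.le] at ht
  have hsin : 0 ≤ sin (a - t) :=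
    sin_nonneg_of_nonneg_of_le_pi (by linarith [ht.2]) (by linarith [ht.1])
  simp only [Ekernel]
  rw [key, max_eq_right (mul_nonneg hpos.le hsin)]

theorem hasDerivAt_Ekernel (σP σR p β : ℝ) {lam : ℝ} (hlam : 1 < lam) {t : ℝ} (ht : 0 < cos t)
    (x : ℝ) :
    HasDerivAt (fun x => Ekernel σP σR p β lam x t)
      (lam * σR * Ekernel σP σR p β (lam - 1) x t) x := by
  have hlin : HasDerivAt (fun x => σR * x * cos t - σP * sin t) (σR * cos t) x := by
    simpa using (((hasDerivAt_id x).const_mul σR).mul_const (cos t)).sub_const (σP * sin t)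
  have h := (((hasDerivAt_max_zero_rpow_s6 hlam _).comp x hlin).const_mul
    (cos t ^ (β - lam))).mul_const (exp (-2 * p * t / (σP * σR)))
  refine h.congr_deriv ?_
  have hcos : cos t ^ (β - (lam - 1)) = cos t ^ (β - lam) * cos t := by
    rw [← rpow_add_one ht.ne']
    ring_nf
  rw [Ekernel, hcos]
  ring

theorem abs_Ekernel_le {σP σR p β lam x t M : ℝ} (hσP : 0 ≤ σP) (hσR : 0 ≤ σR) (h0 : 0 ≤ lam)
    (hlam : lam ≤ β) (ht : 0 ≤ cos t) (hx : |x| ≤ M) :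
    |Ekernel σP σR p β lam x t| ≤ (σR * M + σP) ^ lam * exp (-2 * p * t / (σP * σR)) := by
  have hM : 0 ≤ M := (abs_nonneg x).trans hx
  have hmax : max 0 (σR * x * cos t - σP * sin t) ≤ σR * M + σP := by
    refine max_le (by positivity) ?_
    have h1 : x * cos t ≤ M := by
      have := mul_le_mul hx (cos_le_one t) ht hM
      nlinarith [le_abs_self x]
    nlinarith [neg_one_le_sin t]
  have hnonneg : 0 ≤ Ekernel σP σR p β lam x t := by
    unfold Ekernel
    positivity
  rw [abs_of_nonneg hnonneg, Ekernel]
  gcongr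
  calc cos t ^ (β - lam) * max 0 (σR * x * cos t - σP * sin t) ^ lam
      ≤ 1 * (σR * M + σP) ^ lam := by
        gcongr
        exact rpow_le_one ht (cos_le_one t) (by linarith)
    _ = (σR * M + σP) ^ lam := one_mul _

theorem hasDerivAt_integral_Ekernel {σP σR p β lam : ℝ} (hσP : 0 ≤ σP) (hσR : 0 ≤ σR)
    (hlam : 1 < lam) (hlamβ : lam < β + 1) (y : ℝ) :
    HasDerivAt (fun x => ∫ t in (-(π / 2))..(π / 2), Ekernel σP σR p β lam x t)
      (∫ t in (-(π / 2))..(π / 2), lam * σR * Ekernel σP σR p β (lam - 1) y t) y := by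
  have hpi := Real.pi_pos
  have hcos : ∀ᵐ t : ℝ, t ∈ uIoc (-(π / 2)) (π / 2) → 0 < cos t := by
    filter_upwards [Measure.ae_ne volume (π / 2)] with t hne ht
    rw [uIoc_of_le (by linarith)] at ht
    exact cos_pos_of_mem_Ioo ⟨ht.1, lt_of_le_of_ne ht.2 hne⟩
  refine (intervalIntegral.hasDerivAt_integral_of_dominated_loc_of_deriv_le
    (bound := fun t => lam * σR * ((σR * (|y| + 1) + σP) ^ (lam - 1) *
      exp (-2 * p * t / (σP * σR))))
    (F := Ekernel σP σR p β lam)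
    (F' := fun x t => lam * σR * Ekernel σP σR p β (lam - 1) x t)
    (Metric.ball_mem_nhds y one_pos)
    (Eventually.of_forall fun x => (measurable_Ekernel ..).aestronglyMeasurable)
    (intervalIntegrable_Ekernel σP σR p (by linarith) hlamβ y)
    ((measurable_Ekernel ..).const_mul _).aestronglyMeasurable ?_ ?_ ?_).2
  · filter_upwards [hcos] with t ht hmem x hx
    have hxM : |x| ≤ |y| + 1 := by
      rw [Metric.mem_ball, dist_eq] at hx
      linarith [abs_sub_abs_le_abs_sub x y]
    have hc : 0 ≤ lam * σR := mul_nonneg (by linarith) hσR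
    rw [norm_mul, norm_of_nonneg hc]
    exact mul_le_mul_of_nonneg_left
      (abs_Ekernel_le hσP hσR (by linarith) (by linarith) (ht hmem).le hxM) hc
  · exact Continuous.intervalIntegrable (by fun_prop) _ _
  · filter_upwards [hcos] with t ht hmem x _
    exact hasDerivAt_Ekernel σP σR p β hlam (ht hmem) x

/-- The derivative identity `∂/∂y E(y, λ) = λ E(y, λ-1)`
for `1 < λ < β + 1` (used in Example 4.2 of Yin–Wen). -/
theorem deriv_Efun
    (σP σR p r δ : ℝ)
    (hσP : 0 < σP) (hσR : 0 < σR) (hp : 0 < p) (hr : 0 < r) (hδ : 0 < δ)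
    (β : ℝ)
    (hβ : β = Real.sqrt ((2 * r / σR ^ 2 - 1) ^ 2 + 8 * δ / σR ^ 2) - 1) :
    ∀ lam : ℝ, 1 < lam → lam < β + 1 → ∀ y : ℝ,
      HasDerivAt (fun x => Efun σP σR p β x lam)
        (lam * Efun σP σR p β y (lam - 1)) y := by
  intro lam hlam hlamβ y
  simp only [Efun_eq_integral_Ekernel hσP (by linarith : 0 < lam) hlamβ]
  rw [Efun_eq_integral_Ekernel hσP (by linarith : 0 < lam - 1) (by linarith)]
  refine ((hasDerivAt_integral_Ekernel hσP.le hσR.le hlam hlamβ y).const_mul _).congr_deriv ?_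
  have hpow : σR ^ (-(1 + (lam - 1))) = σR ^ (-(1 + lam)) * σR := by
    rw [← rpow_add_one hσR.ne']
    ring_nf
  rw [intervalIntegral.integral_const_mul, hpow]
  ring
end

section
/- Let σ_P, σ_R, p, r > 0 and δ > 0, and let β = √((2r/σ_R² − 1)² + 8δ/σ_R²) − 1. For every λ with 0 < λ ≤ β, D(x, λ) → 0 as x → +∞. -/
open Real Filter MeasureTheory Set

/-- Past the angle `arctan (b / a)`, the function `a sin t - b cos t` is nonnegative. -/
lemma mul_cos_le_mul_sin_of_arctan_lt {a b t : ℝ} (ha : 0 < a)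
    (h₁ : Real.arctan (b / a) < t) (h₂ : t ≤ Real.pi / 2) :
    b * Real.cos t ≤ a * Real.sin t := by
  rcases h₂.eq_or_lt with rfl | h₂
  · simpa using ha.le
  · have hcos : 0 < Real.cos t :=
      Real.cos_pos_of_mem_Ioo ⟨(Real.neg_pi_div_two_lt_arctan _).trans h₁, h₂⟩
    have htan := Real.tan_lt_tan_of_lt_of_lt_pi_div_two (Real.neg_pi_div_two_lt_arctan _) h₂ h₁
    rw [Real.tan_arctan, Real.tan_eq_sin_div_cos, div_lt_div_iff₀ ha hcos] at htan
    linarith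

lemma norm_Dfun_integrand_le {σP σR p β x lam t : ℝ} (hσP : 0 < σP) (hσR : 0 < σR) (hp : 0 < p)
    (hlam : 0 < lam) (hlβ : lam ≤ β) (hx : 0 ≤ x)
    (ht : t ∈ Set.Ioc (Real.arctan (σR * x / σP)) (Real.pi / 2)) :
    ‖Real.cos t ^ (β - lam) * (σP * Real.sin t - σR * x * Real.cos t) ^ lam *
      Real.exp (-2 * p * t / (σP * σR))‖ ≤ σP ^ lam := by
  have hx' : 0 ≤ σR * x := by positivity
  have ht0 : 0 < t := (Real.arctan_nonneg.2 (by positivity)).trans_lt ht.1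
  have hcos : 0 ≤ Real.cos t := Real.cos_nonneg_of_mem_Icc ⟨by linarith [Real.pi_pos], ht.2⟩
  have hpos : 0 ≤ σP * Real.sin t - σR * x * Real.cos t :=
    sub_nonneg.2 (mul_cos_le_mul_sin_of_arctan_lt hσP ht.1 ht.2)
  have hle : σP * Real.sin t - σR * x * Real.cos t ≤ σP := by
    nlinarith [Real.sin_le_one t, mul_nonneg hx' hcos]
  have hpow : Real.cos t ^ (β - lam) ≤ 1 :=
    Real.rpow_le_one hcos (Real.cos_le_one t) (sub_nonneg.2 hlβ)
  have hexp : Real.exp (-2 * p * t / (σP * σR)) ≤ 1 :=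
    Real.exp_le_one_iff.2 (div_nonpos_of_nonpos_of_nonneg (by nlinarith) (by positivity))
  rw [Real.norm_of_nonneg (by positivity)]
  calc _ ≤ 1 * σP ^ lam * 1 := by gcongr
    _ = σP ^ lam := by ring

/-- `D(x, λ) → 0` as `x → +∞` for every `0 < λ ≤ β`
(boundary condition `g(+∞) = 0` in Example 3.2). -/
theorem Dfun_tendsto_zero
    (σP σR p r δ : ℝ)
    (hσP : 0 < σP) (hσR : 0 < σR) (hp : 0 < p) (hr : 0 < r) (hδ : 0 < δ)
    (β : ℝ)
    (hβ : β = Real.sqrt ((2 * r / σR ^ 2 - 1) ^ 2 + 8 * δ / σR ^ 2) - 1) :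
    ∀ lam : ℝ, 0 < lam → lam ≤ β →
      Filter.Tendsto (fun x => Dfun σP σR p β x lam) Filter.atTop (nhds 0) := by
  intro lam hlam hlβ
  have hatan : Filter.Tendsto (fun x => Real.arctan (σR * x / σP)) Filter.atTop
      (nhds (Real.pi / 2)) :=
    (Real.tendsto_arctan_atTop.mono_right nhdsWithin_le_nhds).comp
      ((Filter.tendsto_id.const_mul_atTop hσR).atTop_div_const hσP)
  have hbound : Filter.Tendsto
      (fun x => σP ^ lam * |Real.pi / 2 - Real.arctan (σR * x / σP)|) Filter.atTop (nhds 0) := by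
    simpa using ((hatan.const_sub (Real.pi / 2)).abs).const_mul (σP ^ lam)
  unfold Dfun
  rw [← mul_zero (σP ^ (-(1 + β)) * σR ^ (-(1 + lam)))]
  refine Filter.Tendsto.const_mul _ (squeeze_zero_norm' ?_ hbound)
  filter_upwards [Filter.eventually_ge_atTop 0] with x hx
  refine intervalIntegral.norm_integral_le_of_norm_le_const fun t ht => ?_
  rw [Set.uIoc_of_le (Real.arctan_lt_pi_div_two _).le] at ht
  exact norm_Dfun_integrand_le hσP hσR hp hlam hlβ hx ht
end

section
/- Let σ_P, σ_R, r > 0, δ > r, μ > 0 and p > μ. Set β = √((2r/σ_R² − 1)² + 8δ/σ_R²) − 1 and α = ½[√((2r/σ_R² − 1)² + 8δ/σ_R²) − (1 + 2r/σ_R²)], and let D₁(x, λ) and E₁(x, λ) be defined exactly as D(x, λ) and E(x, λ) but with p replaced by p − μ in the exponential factor, i.e. with exp(−2(p−μ)t/(σ_Pσ_R)) in place of exp(−2pt/(σ_Pσ_R)). Then for any constants c₁, c₂ ∈ ℝ, the function V(u) := c₁ D₁(u, α+1) + c₂ E₁(u, α+1) + μ/δ is twice differentiable on ℝ and satisfies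 ½(σ_P² + σ_R² u²) V''(u) + (p − μ + r u) V'(u) + μ = δ V(u) for all u ∈ ℝ. -/
open Real Filter MeasureTheory Set

/-- The (unnormalised) Pearson type IV density `(1 + (a z)²)^(-κ) exp(-c arctan(a z))`. -/
noncomputable def pearsonIV (a c κ z : ℝ) : ℝ :=
  (1 + (a * z) ^ 2) ^ (-κ) * exp (-c * arctan (a * z))

/-- The one-sided fractional moment `∫₀^∞ s^l w(x + s) ds` of the Pearson type IV density `w`. -/
noncomputable def pearsonMoment (a c κ l x : ℝ) : ℝ :=
  ∫ s in Ioi (0 : ℝ), s ^ l * pearsonIV a c κ (x + s)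

lemma pearsonIV_pos (a c κ z : ℝ) : 0 < pearsonIV a c κ z := by
  unfold pearsonIV; positivity

lemma continuous_pearsonIV (a c κ : ℝ) : Continuous (pearsonIV a c κ) := by
  unfold pearsonIV
  refine Continuous.mul (Continuous.rpow_const (by fun_prop) fun z => Or.inl (by positivity)) ?_
  exact Real.continuous_exp.comp
    (continuous_const.mul (Real.continuous_arctan.comp (continuous_const.mul continuous_id)))

lemma pearsonIV_eq_mul_add_one (a c κ z : ℝ) :
    pearsonIV a c κ z = (1 + (a * z) ^ 2) * pearsonIV a c (κ + 1) z := by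
  have hk : 0 < 1 + (a * z) ^ 2 := by positivity
  unfold pearsonIV
  rw [neg_add, Real.rpow_add hk, Real.rpow_neg_one]
  field_simp

lemma hasDerivAt_pearsonIV (a c κ z : ℝ) :
    HasDerivAt (pearsonIV a c κ)
      (-(2 * κ * a ^ 2 * z + c * a) * pearsonIV a c (κ + 1) z) z := by
  have hk : 0 < 1 + (a * z) ^ 2 := by positivity
  have hlin : HasDerivAt (fun z => a * z) a z := by simpa using (hasDerivAt_id z).const_mul a
  have h₁ := ((hlin.pow 2).const_add 1).rpow_const (p := -κ) (Or.inl hk.ne')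
  have h₂ := (hlin.arctan.const_mul (-c)).exp
  have h₃ := h₁.mul h₂
  refine h₃.congr_deriv ?_
  have hpow : (1 + (a * z) ^ 2) ^ (-κ) = (1 + (a * z) ^ 2) ^ (-(κ + 1)) * (1 + (a * z) ^ 2) := by
    rw [← Real.rpow_add_one hk.ne']; congr 1; ring
  simp only [pearsonIV, Pi.pow_apply, hpow, show -κ - 1 = -(κ + 1) by ring, Nat.cast_ofNat,
    Nat.add_one_sub_one, pow_one]
  field_simp
  ring

/-- The Pearson type IV density decays like `(1 + s)^(-2κ)`, locally uniformly in the base point. -/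
lemma exists_pearsonIV_le {a : ℝ} (ha : 0 < a) (c : ℝ) {κ : ℝ} (hκ : 0 < κ) (R : ℝ) :
    ∃ C, 0 < C ∧ ∀ x, |x| ≤ R → ∀ s, 0 < s →
      pearsonIV a c κ (x + s) ≤ C * (1 + s) ^ (-(2 * κ)) := by
  obtain ⟨K, hK⟩ : ∃ K, K = 2 * (1 + R) ^ 2 + 2 / a ^ 2 := ⟨_, rfl⟩
  have hK0 : 0 < K := by rw [hK]; positivity
  refine ⟨K ^ κ * exp (|c| * (π / 2)), by positivity, fun x hx s hs => ?_⟩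
  have hquad : (1 + s) ^ 2 / K ≤ 1 + (a * (x + s)) ^ 2 := by
    rw [div_le_iff₀ hK0]
    have hx' := abs_le.1 hx
    have h₁ : (1 + s) ^ 2 ≤ 2 * (1 + R) ^ 2 + 2 * (x + s) ^ 2 := by
      have h0 : 1 + s ≤ (1 + R) + |x + s| := by linarith [le_abs_self (x + s)]
      have := pow_le_pow_left₀ (by linarith) h0 2
      nlinarith [sq_abs (x + s), sq_nonneg (1 + R - |x + s|)]
    have h₂ : 2 * (x + s) ^ 2 = 2 / a ^ 2 * (a * (x + s)) ^ 2 := by field_simp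
    have h₃ : 0 ≤ 2 / a ^ 2 := by positivity
    rw [hK]
    nlinarith [mul_nonneg (sq_nonneg (1 + R)) (sq_nonneg (a * (x + s)))]
  have h₁ : (1 + (a * (x + s)) ^ 2) ^ (-κ) ≤ K ^ κ * (1 + s) ^ (-(2 * κ)) := by
    have h := Real.rpow_le_rpow_of_nonpos (by positivity) hquad (neg_nonpos.2 hκ.le)
    rwa [Real.div_rpow (by positivity) hK0.le, Real.rpow_neg hK0.le, div_inv_eq_mul,
      ← Real.rpow_two (1 + s), ← Real.rpow_mul (by positivity), mul_comm _ (K ^ κ), mul_neg] at h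
  have h₂ : exp (-c * arctan (a * (x + s))) ≤ exp (|c| * (π / 2)) := by
    refine exp_le_exp.2 ((le_abs_self _).trans ?_)
    rw [abs_mul, abs_neg]
    gcongr
    exact abs_le.2 ⟨(neg_pi_div_two_lt_arctan _).le, (arctan_lt_pi_div_two _).le⟩
  calc pearsonIV a c κ (x + s)
      ≤ K ^ κ * (1 + s) ^ (-(2 * κ)) * exp (|c| * (π / 2)) := by
        unfold pearsonIV; gcongr
    _ = _ := by ring

lemma integrableOn_rpow_mul_one_add_rpow {l ν : ℝ} (hl : -1 < l) (hν : l < ν - 1) :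
    IntegrableOn (fun s : ℝ => s ^ l * (1 + s) ^ (-ν)) (Ioi 0) := by
  have hmeas : ∀ S : Set ℝ,
      AEStronglyMeasurable (fun s : ℝ => s ^ l * (1 + s) ^ (-ν)) (volume.restrict S) := fun S =>
    (by fun_prop : Measurable fun s : ℝ => s ^ l * (1 + s) ^ (-ν)).aestronglyMeasurable
  rw [← Ioc_union_Ioi_eq_Ioi zero_le_one]
  refine IntegrableOn.union ?_ ?_
  · have h : IntegrableOn (fun s : ℝ => s ^ l) (Ioc 0 1) :=
      (intervalIntegrable_iff_integrableOn_Ioc_of_le zero_le_one).1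
        (intervalIntegral.intervalIntegrable_rpow' hl)
    refine h.mono' (hmeas _) ?_
    filter_upwards [ae_restrict_mem measurableSet_Ioc] with s hs
    have hs0 : 0 < s := hs.1
    rw [Real.norm_of_nonneg (by positivity)]
    exact mul_le_of_le_one_right (by positivity)
      (Real.rpow_le_one_of_one_le_of_nonpos (by linarith) (by linarith))
  · have h : IntegrableOn (fun s : ℝ => s ^ (l - ν)) (Ioi 1) :=
      integrableOn_Ioi_rpow_of_lt (by linarith) one_pos
    refine h.mono' (hmeas _) ?_
    filter_upwards [ae_restrict_mem measurableSet_Ioi] with s hs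
    have hs0 : 0 < s := one_pos.trans hs
    rw [Real.norm_of_nonneg (by positivity), sub_eq_add_neg, Real.rpow_add hs0]
    exact mul_le_mul_of_nonneg_left
      (Real.rpow_le_rpow_of_nonpos hs0 (by linarith) (by linarith)) (by positivity)

lemma integrableOn_rpow_mul_pearsonIV {a : ℝ} (ha : 0 < a) (c : ℝ) {κ l : ℝ} (hl : -1 < l)
    (hκ : l < 2 * κ - 1) (x : ℝ) :
    IntegrableOn (fun s => s ^ l * pearsonIV a c κ (x + s)) (Ioi 0) := by
  obtain ⟨C, hC, hb⟩ := exists_pearsonIV_le ha c (show 0 < κ by linarith) |x|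
  refine ((integrableOn_rpow_mul_one_add_rpow hl hκ).const_mul C).mono' ?_ ?_
  · have := (continuous_pearsonIV a c κ).measurable
    exact (by fun_prop : Measurable fun s => s ^ l * pearsonIV a c κ (x + s)).aestronglyMeasurable
  · filter_upwards [ae_restrict_mem measurableSet_Ioi] with s hs
    have hs0 : 0 < s := hs
    have hw := pearsonIV_pos a c κ (x + s)
    rw [Real.norm_of_nonneg (by positivity)]
    calc s ^ l * pearsonIV a c κ (x + s) ≤ s ^ l * (C * (1 + s) ^ (-(2 * κ))) := by
          gcongr; exact hb x le_rfl s hs0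
      _ = _ := by ring

lemma tendsto_rpow_mul_pearsonIV_atTop {a : ℝ} (ha : 0 < a) (c : ℝ) {κ l : ℝ} (hl : 0 ≤ l)
    (hκ : l < 2 * κ) (x : ℝ) :
    Tendsto (fun s => s ^ l * pearsonIV a c κ (x + s)) atTop (nhds 0) := by
  obtain ⟨C, hC, hb⟩ := exists_pearsonIV_le ha c (show 0 < κ by linarith) |x|
  have hlim : Tendsto (fun s : ℝ => C * s ^ (-(2 * κ - l))) atTop (nhds 0) := by
    simpa using (tendsto_rpow_neg_atTop (show 0 < 2 * κ - l by linarith)).const_mul C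
  refine squeeze_zero' ?_ ?_ hlim
  · filter_upwards [eventually_gt_atTop 0] with s hs
    have hw := pearsonIV_pos a c κ (x + s)
    positivity
  · filter_upwards [eventually_gt_atTop 0] with s hs
    calc s ^ l * pearsonIV a c κ (x + s) ≤ s ^ l * (C * s ^ (-(2 * κ))) := by
          gcongr
          exact (hb x le_rfl s hs).trans (mul_le_mul_of_nonneg_left
            (Real.rpow_le_rpow_of_nonpos hs (by linarith) (by linarith)) hC.le)
      _ = C * s ^ (-(2 * κ - l)) := by
          rw [show -(2 * κ - l) = l + -(2 * κ) by ring, Real.rpow_add hs]; ring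

lemma hasDerivAt_pearsonIV_add (a c κ x s : ℝ) :
    HasDerivAt (fun s => pearsonIV a c κ (x + s))
      (-(2 * κ * a ^ 2 * (x + s) + c * a) * pearsonIV a c (κ + 1) (x + s)) s :=
  (hasDerivAt_pearsonIV a c κ (x + s)).comp_const_add x s

/-- Fundamental theorem of calculus for `s^l w(x + s)` on the half line. -/
lemma integral_deriv_rpow_mul_pearsonIV {a : ℝ} (ha : 0 < a) (c : ℝ) {κ l : ℝ} (hl : 0 < l)
    (hκ : l < 2 * κ) (x : ℝ)
    (hint : IntegrableOn (fun s => l * s ^ (l - 1) * pearsonIV a c κ (x + s) +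
      s ^ l * (-(2 * κ * a ^ 2 * (x + s) + c * a) * pearsonIV a c (κ + 1) (x + s))) (Ioi 0)) :
    ∫ s in Ioi (0 : ℝ), (l * s ^ (l - 1) * pearsonIV a c κ (x + s) +
      s ^ l * (-(2 * κ * a ^ 2 * (x + s) + c * a) * pearsonIV a c (κ + 1) (x + s))) = 0 := by
  have hcont : Continuous fun s => s ^ l * pearsonIV a c κ (x + s) :=
    (Real.continuous_rpow_const hl.le).mul
      ((continuous_pearsonIV a c κ).comp (continuous_const.add continuous_id))
  have h := integral_Ioi_of_hasDerivAt_of_tendsto (f := fun s => s ^ l * pearsonIV a c κ (x + s))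
    hcont.continuousWithinAt
    (fun s hs => (Real.hasDerivAt_rpow_const (Or.inl (ne_of_gt hs))).mul
      (hasDerivAt_pearsonIV_add a c κ x s)) hint
    (tendsto_rpow_mul_pearsonIV_atTop ha c hl.le hκ x)
  rw [h]
  simp [Real.zero_rpow hl.ne']

/-- The logarithmic derivative of the Pearson type IV density is bounded. -/
lemma exists_abs_deriv_pearsonIV_le {a : ℝ} (ha : 0 < a) (c κ : ℝ) :
    ∃ M, 0 < M ∧ ∀ z, |-(2 * κ * a ^ 2 * z + c * a) * pearsonIV a c (κ + 1) z| ≤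
      M * pearsonIV a c κ z := by
  refine ⟨2 * |κ| * a + |c| * a + 1, by positivity, fun z => ?_⟩
  have hw := pearsonIV_pos a c (κ + 1) z
  rw [pearsonIV_eq_mul_add_one a c κ z, abs_mul, abs_of_pos hw, abs_neg, ← mul_assoc]
  gcongr
  have h₁ : |2 * κ * a ^ 2 * z + c * a| ≤ 2 * |κ| * a * |a * z| + |c| * a := by
    refine (abs_add_le _ _).trans (le_of_eq ?_)
    simp only [abs_mul, abs_pow, abs_of_pos ha, abs_two]
    ring
  have h₂ : |a * z| ≤ 1 + (a * z) ^ 2 := by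
    nlinarith [sq_abs (a * z), sq_nonneg (|a * z| - 1), abs_nonneg (a * z)]
  have h₃ : 2 * |κ| * a * |a * z| ≤ 2 * |κ| * a * (1 + (a * z) ^ 2) := by gcongr
  nlinarith [sq_nonneg (a * z), mul_nonneg (by positivity : 0 ≤ |c| * a) (sq_nonneg (a * z))]

lemma hasDerivAt_pearsonMoment {a : ℝ} (ha : 0 < a) (c : ℝ) {κ l : ℝ} (hl : 0 < l)
    (hκ : l < 2 * κ - 1) (x : ℝ) :
    HasDerivAt (pearsonMoment a c κ l) (-l * pearsonMoment a c κ (l - 1) x) x := by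
  obtain ⟨C, hC, hb⟩ := exists_pearsonIV_le ha c (show 0 < κ by linarith) (|x| + 1)
  obtain ⟨M, hM, hd⟩ := exists_abs_deriv_pearsonIV_le ha c κ
  have hmeas : ∀ κ', Measurable (pearsonIV a c κ') :=
    fun κ' => (continuous_pearsonIV a c κ').measurable
  have hm := hmeas κ
  have hm' := hmeas (κ + 1)
  obtain ⟨hint', hderiv⟩ := hasDerivAt_integral_of_dominated_loc_of_deriv_le
    (μ := volume.restrict (Ioi (0 : ℝ))) (x₀ := x) (s := Metric.ball x 1)
    (F := fun y s => s ^ l * pearsonIV a c κ (y + s))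
    (F' := fun y s => s ^ l *
      (-(2 * κ * a ^ 2 * (y + s) + c * a) * pearsonIV a c (κ + 1) (y + s)))
    (bound := fun s => M * C * (s ^ l * (1 + s) ^ (-(2 * κ))))
    (Metric.ball_mem_nhds x one_pos)
    (Eventually.of_forall fun y =>
      (by fun_prop : Measurable fun s => s ^ l * pearsonIV a c κ (y + s)).aestronglyMeasurable)
    (integrableOn_rpow_mul_pearsonIV ha c (by linarith) hκ x)
    (by fun_prop : Measurable fun s => s ^ l *
      (-(2 * κ * a ^ 2 * (x + s) + c * a) * pearsonIV a c (κ + 1) (x + s))).aestronglyMeasurable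
    (by
      filter_upwards [ae_restrict_mem measurableSet_Ioi] with s hs y hy
      have hs0 : 0 < s := hs
      have hy' : |y| ≤ |x| + 1 := by
        have h₁ : |y - x| < 1 := by simpa [Real.dist_eq] using hy
        have h₂ := abs_sub_abs_le_abs_sub y x
        linarith
      rw [norm_mul, Real.norm_of_nonneg (by positivity : 0 ≤ s ^ l), Real.norm_eq_abs]
      calc _ ≤ s ^ l * (M * (C * (1 + s) ^ (-(2 * κ)))) := by
            gcongr
            exact (hd _).trans (by gcongr; exact hb y hy' s hs0)
        _ = _ := by ring)
    ((integrableOn_rpow_mul_one_add_rpow (by linarith) hκ).const_mul (M * C))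
    (Eventually.of_forall fun s y _ =>
      ((hasDerivAt_pearsonIV a c κ (y + s)).comp_add_const y s).const_mul (s ^ l))
  refine hderiv.congr_deriv ?_
  have hint : IntegrableOn (fun s => l * s ^ (l - 1) * pearsonIV a c κ (x + s)) (Ioi 0) := by
    simp only [mul_assoc]
    exact (integrableOn_rpow_mul_pearsonIV ha c (by linarith) (by linarith) x).const_mul l
  have h := integral_deriv_rpow_mul_pearsonIV ha c hl (by linarith) x (hint.add hint')
  rw [integral_add hint hint'] at h
  simp only [mul_assoc l] at h
  rw [integral_const_mul] at h
  unfold pearsonMoment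
  linarith

/-- The three-term recurrence between consecutive moments. -/
lemma pearsonMoment_recurrence {a : ℝ} (ha : 0 < a) (c : ℝ) {b l : ℝ} (hl : 0 < l)
    (hb : l < b) (x : ℝ) :
    l * (1 + (a * x) ^ 2) * pearsonMoment a c (b / 2 + 1) (l - 1) x +
      ((2 * l - b) * a ^ 2 * x - c * a) * pearsonMoment a c (b / 2 + 1) l x +
      (l - b) * a ^ 2 * pearsonMoment a c (b / 2 + 1) (l + 1) x = 0 := by
  have hi := fun j (hj : -1 < j) (hj' : j < b + 1) =>
    integrableOn_rpow_mul_pearsonIV ha c (κ := b / 2 + 1) hj (by linarith) x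
  have h₀ := (hi (l - 1) (by linarith) (by linarith)).const_mul (l * (1 + (a * x) ^ 2))
  have h₁ := (hi l (by linarith) (by linarith)).const_mul ((2 * l - b) * a ^ 2 * x - c * a)
  have h₂ := (hi (l + 1) (by linarith) (by linarith)).const_mul ((l - b) * a ^ 2)
  have heq : EqOn (fun s => l * s ^ (l - 1) * pearsonIV a c (b / 2) (x + s) +
      s ^ l * (-(2 * (b / 2) * a ^ 2 * (x + s) + c * a) * pearsonIV a c (b / 2 + 1) (x + s)))
      (fun s => l * (1 + (a * x) ^ 2) * (s ^ (l - 1) * pearsonIV a c (b / 2 + 1) (x + s)) +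
      ((2 * l - b) * a ^ 2 * x - c * a) * (s ^ l * pearsonIV a c (b / 2 + 1) (x + s)) +
      (l - b) * a ^ 2 * (s ^ (l + 1) * pearsonIV a c (b / 2 + 1) (x + s))) (Ioi 0) := by
    intro s hs
    have hs0 : s ≠ 0 := ne_of_gt hs
    have e₁ : s ^ l = s ^ (l - 1) * s := by
      rw [← Real.rpow_add_one hs0, sub_add_cancel]
    simp only [Real.rpow_add_one hs0 l, e₁, pearsonIV_eq_mul_add_one a c (b / 2)]
    ring
  have h := integral_deriv_rpow_mul_pearsonIV ha c hl (κ := b / 2) (by linarith) x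
    ((integrableOn_congr_fun heq measurableSet_Ioi).2 ((h₀.add h₁).add h₂))
  rw [setIntegral_congr_fun measurableSet_Ioi heq, integral_add (by exact h₀.add h₁) h₂,
    integral_add h₀ h₁] at h
  simpa only [integral_const_mul, pearsonMoment] using h

lemma image_arctan_Ioi {a : ℝ} (ha : 0 < a) (x : ℝ) :
    (fun s => arctan (a * (x + s))) '' Ioi 0 = Ioo (arctan (a * x)) (π / 2) := by
  ext t
  constructor
  · rintro ⟨s, hs, rfl⟩
    have hs0 : 0 < s := hs
    exact ⟨arctan_strictMono (by nlinarith), arctan_lt_pi_div_two _⟩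
  · rintro ⟨h₁, h₂⟩
    have h₃ : a * x < tan t := by
      rw [← tan_arctan (a * x)]
      exact tan_lt_tan_of_lt_of_lt_pi_div_two (neg_pi_div_two_lt_arctan _) h₂ h₁
    refine ⟨tan t / a - x, ?_, ?_⟩
    · rw [mem_Ioi, sub_pos, lt_div_iff₀ ha]; linarith
    · simp only [add_sub_cancel]
      rw [mul_div_cancel₀ _ ha.ne',
        arctan_tan ((neg_pi_div_two_lt_arctan _).trans h₁) h₂]

/-- After the substitution `t = arctan (σR (x + s) / σP)`, `Dfun` is a multiple of a moment. -/
lemma exists_Dfun_eq_pearsonMoment {σP σR : ℝ} (hσP : 0 < σP) (hσR : 0 < σR) (q β l : ℝ) :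
    ∃ K, ∀ x, Dfun σP σR q β x l =
      K * pearsonMoment (σR / σP) (2 * q / (σP * σR)) (β / 2 + 1) l x := by
  refine ⟨σP ^ (-(1 + β)) * σR ^ (-(1 + l)) * (σR / σP * σR ^ l), fun x => ?_⟩
  have ha : 0 < σR / σP := by positivity
  unfold Dfun
  rw [mul_assoc (σP ^ (-(1 + β)) * σR ^ (-(1 + l)))]
  congr 1
  rw [intervalIntegral.integral_of_le (arctan_lt_pi_div_two _).le,
    integral_Ioc_eq_integral_Ioo, mul_div_right_comm, ← image_arctan_Ioi ha x,
    integral_image_eq_integral_abs_deriv_smul (f' := fun s =>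
      1 / (1 + (σR / σP * (x + s)) ^ 2) * (σR / σP)) measurableSet_Ioi
      (fun s _ => by
        have hlin : HasDerivAt (fun s => σR / σP * (x + s)) (σR / σP) s := by
          simpa using ((hasDerivAt_id s).const_add x).const_mul (σR / σP)
        exact hlin.arctan.hasDerivWithinAt)
      (fun s _ s' _ h => by
        have := mul_left_cancel₀ ha.ne' (arctan_injective h)
        linarith),
    pearsonMoment, ← integral_const_mul]
  refine setIntegral_congr_fun measurableSet_Ioi fun s hs => ?_
  have hs0 : 0 < s := hs
  set k := 1 + (σR / σP * (x + s)) ^ 2 with hk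
  have hk0 : 0 < k := by positivity
  have hlin : σP * sin (arctan (σR / σP * (x + s))) - σR * x * cos (arctan (σR / σP * (x + s)))
      = σR * s * cos (arctan (σR / σP * (x + s))) := by
    rw [sin_arctan, cos_arctan]; field_simp; ring
  have hcos : cos (arctan (σR / σP * (x + s))) = k ^ (-(1 / 2) : ℝ) := by
    rw [cos_arctan, Real.rpow_neg hk0.le, ← Real.sqrt_eq_rpow, one_div]
  have hc0 : 0 < cos (arctan (σR / σP * (x + s))) := cos_arctan_pos _
  simp only [smul_eq_mul, hlin]
  rw [abs_of_pos (by positivity), Real.mul_rpow (by positivity) hc0.le,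
    Real.mul_rpow hσR.le hs0.le, pearsonIV, ← hk]
  have hpow : cos (arctan (σR / σP * (x + s))) ^ (β - l) *
      cos (arctan (σR / σP * (x + s))) ^ l * (1 / k) = k ^ (-(β / 2 + 1)) := by
    rw [← Real.rpow_add hc0, hcos, ← Real.rpow_mul hk0.le, one_div k, ← Real.rpow_neg_one k,
      ← Real.rpow_add hk0]
    congr 1; ring
  have hexp : -2 * q * arctan (σR / σP * (x + s)) / (σP * σR) =
      -(2 * q / (σP * σR)) * arctan (σR / σP * (x + s)) := by ring
  rw [hexp, ← hpow]
  ring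

lemma Efun_eq_Dfun_neg (σP σR q β l x : ℝ) :
    Efun σP σR q β x l = Dfun σP σR (-q) β (-x) l := by
  unfold Efun Dfun
  have h := intervalIntegral.integral_comp_neg (a := -(π / 2)) (b := arctan (σR * x / σP))
    fun t => cos t ^ (β - l) * (σP * sin t - σR * -x * cos t) ^ l * exp (-2 * -q * t / (σP * σR))
  rw [neg_neg] at h
  rw [mul_neg, neg_div, arctan_neg, ← mul_neg, ← h]
  congr 2 with t
  rw [cos_neg, sin_neg]
  congr 3 <;> ring

/-- `Dfun` is twice differentiable in its spatial variable and solves the homogeneous equation. -/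
lemma exists_hasDerivAt_Dfun {σP σR r δ β α : ℝ} (hσP : 0 < σP) (hσR : 0 < σR) (hα : 0 < α)
    (hαβ : α < β) (hβ : β = 2 * α + 2 * r / σR ^ 2)
    (hδ : δ = (α + 1) * (α * σR ^ 2 / 2 + r)) (q : ℝ) :
    ∃ y' y'' : ℝ → ℝ, ∀ x,
      HasDerivAt (fun x => Dfun σP σR q β x (α + 1)) (y' x) x ∧ HasDerivAt y' (y'' x) x ∧
      1 / 2 * (σP ^ 2 + σR ^ 2 * x ^ 2) * y'' x + (q + r * x) * y' x =
        δ * Dfun σP σR q β x (α + 1) := by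
  obtain ⟨K, hK⟩ := exists_Dfun_eq_pearsonMoment hσP hσR q β (α + 1)
  have ha : 0 < σR / σP := by positivity
  set J := pearsonMoment (σR / σP) (2 * q / (σP * σR)) (β / 2 + 1) with hJ
  have hd := fun (j : ℝ) (hj : 0 < j) (hj' : j < β + 1) x =>
    hasDerivAt_pearsonMoment ha (2 * q / (σP * σR)) (κ := β / 2 + 1) hj (by linarith) x
  refine ⟨fun x => K * (-(α + 1) * J α x), fun x => K * (-(α + 1) * (-α * J (α - 1) x)),
    fun x => ⟨?_, ?_, ?_⟩⟩
  · have h := (hd (α + 1) (by linarith) (by linarith) x).const_mul K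
    rw [add_sub_cancel_right] at h
    exact h.congr_of_eventuallyEq (Eventually.of_forall hK)
  · exact ((hd α hα (by linarith) x).const_mul (-(α + 1))).const_mul K
  · have h := pearsonMoment_recurrence ha (2 * q / (σP * σR)) hα hαβ x
    rw [← hJ] at h
    have hr : r = (β - 2 * α) * σR ^ 2 / 2 := by rw [hβ]; field_simp; ring
    have h' := congrArg (fun v => K * (α + 1) * σP ^ 2 / 2 * v) h
    simp only [mul_zero] at h'
    rw [hK, hδ, hr]
    rw [← sub_eq_zero, ← h']
    field_simp
    ring

/-- Example 4.1 (threshold strategy, `ρ = 0`), above the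
threshold: with `D₁, E₁` defined as `D, E` but with `p` replaced by `p - μ`,
every `V(u) = c₁ D₁(u, α+1) + c₂ E₁(u, α+1) + μ/δ` solves the inhomogeneous
equation `½(σP² + σR² u²)V'' + (p - μ + ru)V' + μ = δ V` on `ℝ`. -/
theorem threshold_dividend_general_solution
    (σP σR p r δ μ : ℝ)
    (hσP : 0 < σP) (hσR : 0 < σR) (hr : 0 < r) (hδ : r < δ)
    (hμ : 0 < μ) (hpμ : μ < p)
    (β α : ℝ)
    (hβ : β = Real.sqrt ((2 * r / σR ^ 2 - 1) ^ 2 + 8 * δ / σR ^ 2) - 1)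
    (hα : α = (Real.sqrt ((2 * r / σR ^ 2 - 1) ^ 2 + 8 * δ / σR ^ 2)
        - (1 + 2 * r / σR ^ 2)) / 2)
    (c₁ c₂ : ℝ) (V : ℝ → ℝ)
    (hV : V = fun u => c₁ * Dfun σP σR (p - μ) β u (α + 1)
        + c₂ * Efun σP σR (p - μ) β u (α + 1) + μ / δ) :
    (∀ x : ℝ, DifferentiableAt ℝ V x ∧ DifferentiableAt ℝ (deriv V) x) ∧
    ∀ u : ℝ,
      (1 / 2) * (σP ^ 2 + σR ^ 2 * u ^ 2) * deriv (deriv V) u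
        + (p - μ + r * u) * deriv V u + μ = δ * V u := by
  have hδ0 : 0 < δ := hr.trans hδ
  set m := Real.sqrt ((2 * r / σR ^ 2 - 1) ^ 2 + 8 * δ / σR ^ 2) with hm
  have hρ : 0 < 2 * r / σR ^ 2 := by positivity
  have hm2 : m ^ 2 = (2 * r / σR ^ 2 - 1) ^ 2 + 8 * δ / σR ^ 2 :=
    Real.sq_sqrt (by positivity)
  have hm1 : 1 + 2 * r / σR ^ 2 < m := by
    rw [hm]
    refine Real.lt_sqrt_of_sq_lt ?_
    have h : 8 * r / σR ^ 2 < 8 * δ / σR ^ 2 := by gcongr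
    have h' : 8 * r / σR ^ 2 = 4 * (2 * r / σR ^ 2) := by ring
    nlinarith
  have hα0 : 0 < α := by rw [hα]; linarith
  have hαβ : α < β := by rw [hα, hβ]; linarith
  have hβα : β = 2 * α + 2 * r / σR ^ 2 := by rw [hα, hβ]; ring
  have hδα : δ = (α + 1) * (α * σR ^ 2 / 2 + r) := by
    have h : (α + 1) * (α * σR ^ 2 / 2 + r) =
        σR ^ 2 / 8 * (m ^ 2 - (2 * r / σR ^ 2 - 1) ^ 2) := by
      rw [hα]; field_simp; ring
    rw [h, hm2]; field_simp; ring
  obtain ⟨D', D'', hD⟩ := exists_hasDerivAt_Dfun hσP hσR hα0 hαβ hβα hδα (p - μ)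
  obtain ⟨E', E'', hE⟩ := exists_hasDerivAt_Dfun hσP hσR hα0 hαβ hβα hδα (-(p - μ))
  simp only [Efun_eq_Dfun_neg] at hV
  have hV' : ∀ x, HasDerivAt V (c₁ * D' x + c₂ * -E' (-x)) x := fun x => by
    have h := (((hD x).1.const_mul c₁).add
      (((hE (-x)).1.comp x (hasDerivAt_neg x)).const_mul c₂)).add_const (μ / δ)
    rw [hV]
    refine h.congr_deriv ?_
    ring
  have hdV : deriv V = fun x => c₁ * D' x + c₂ * -E' (-x) := funext fun x => (hV' x).deriv
  have hV'' : ∀ x, HasDerivAt (deriv V) (c₁ * D'' x + c₂ * E'' (-x)) x := fun x => by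
    have h := ((hD x).2.1.const_mul c₁).add
      ((((hE (-x)).2.1.comp x (hasDerivAt_neg x)).neg).const_mul c₂)
    rw [hdV]
    refine h.congr_deriv ?_
    ring
  refine ⟨fun x => ⟨(hV' x).differentiableAt, (hV'' x).differentiableAt⟩, fun u => ?_⟩
  have h₁ := (hD u).2.2
  have h₂ := (hE (-u)).2.2
  have h₃ : δ * (μ / δ) = μ := mul_div_cancel₀ _ hδ0.ne'
  rw [(hV'' u).deriv, (hV' u).deriv, hV]
  linear_combination c₁ * h₁ + c₂ * h₂ - h₃
end
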